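/- Let m, n ≥ 1 with d := m + n ≥ 3, let F be an imaginary quadratic number field with ring of integers 𝒪 and discriminant Δ_F, let 𝔍 be a nonzero ideal of 𝒪, and let v ∈ 𝒪^m × 𝒪^n. Let ψ : [1,∞) → (0,∞) be a decreasing function with ∫_1^∞ ψ(t) dt = ∞. Then for Lebesgue almost every θ ∈ M_{m×n}(ℂ), N(θ, T, v, 𝔍) ∼ 2^d |Δ_F|^{−d/2} N(𝔍)^{−d} vol(E_{T,∞}) as T → ∞, i.e. the ratio of the two sides tends to 1. -/

import Mathlib

open MeasureTheory NumberField Filter Topology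
open scoped ENNReal NNReal

noncomputable section

/-- `‖x‖_∞ = max_i |x_i|²`: the supremum of the squared absolute values of the
coordinates (the normalized absolute value at a complex place). -/
def cnorm {k : Type*} [Fintype k] (x : k → ℂ) : ℝ := ⨆ i, Complex.normSq (x i)

/-- The archimedean region
`E_{T,∞} = {(x,y) ∈ ℂ^m × ℂ^n : ‖x‖_∞^m ≤ ψ(‖y‖_∞^n), 1 ≤ ‖y‖_∞^n < T}`. -/
def Einf (m n : ℕ) (ψ : ℝ → ℝ) (T : ℝ) : Set ((Fin m → ℂ) × (Fin n → ℂ)) :=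
  {z | cnorm z.1 ^ m ≤ ψ (cnorm z.2 ^ n) ∧ 1 ≤ cnorm z.2 ^ n ∧ cnorm z.2 ^ n < T}

instance {m n : Type*} [Fintype m] [Fintype n] : MeasureSpace (Matrix m n ℂ) :=
  (inferInstanceAs (MeasureSpace (m → n → ℂ)))

/-- The number `N(θ, T, v, 𝔍)` of solutions `(p,q) ∈ 𝒪^m × 𝒪^n` of
`‖θq + p‖_∞^m ≤ ψ(‖q‖_∞^n)`, `1 ≤ ‖q‖_∞^n < T`, `(p,q) ≡ v (mod 𝔍)`,
where `𝒪` is embedded in `ℂ` via `ι`. -/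
def solCount (F : Type*) [Field F] [NumberField F] (ι : F →+* ℂ)
    (m n : ℕ) (ψ : ℝ → ℝ) (J : Ideal (𝓞 F))
    (v : (Fin m → 𝓞 F) × (Fin n → 𝓞 F)) (θ : Matrix (Fin m) (Fin n) ℂ) (T : ℝ) : ℕ :=
  Nat.card {pq : (Fin m → 𝓞 F) × (Fin n → 𝓞 F) //
    cnorm (fun i => θ.mulVec (fun j => ι (pq.2 j : F)) i + ι (pq.1 i : F)) ^ m
        ≤ ψ (cnorm (fun j => ι (pq.2 j : F)) ^ n) ∧
    1 ≤ cnorm (fun j => ι (pq.2 j : F)) ^ n ∧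
    cnorm (fun j => ι (pq.2 j : F)) ^ n < T ∧
    (∀ i, pq.1 i - v.1 i ∈ J) ∧ (∀ j, pq.2 j - v.2 j ∈ J)}

section Tile

variable {E : Type*}

/-- `D` meets every coset of the countable subgroup `L` exactly once. -/
structure IsTile [AddCommGroup E] [MeasurableSpace E] (L : AddSubgroup E) (D : Set E) : Prop where
  countable : Countable L
  measurableSet : MeasurableSet D
  existsUnique : ∀ x, ∃! g : L, (g : E) + x ∈ D

/-- The subgroup of families with all entries in `L`. -/
def piSubgroup (ι : Type*) [AddCommGroup E] (L : AddSubgroup E) : AddSubgroup (ι → E) where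
  carrier := {f | ∀ i, f i ∈ L}
  zero_mem' := fun _ => L.zero_mem
  add_mem' := fun hf hg i => L.add_mem (hf i) (hg i)
  neg_mem' := fun hf i => L.neg_mem (hf i)

theorem mem_piSubgroup {ι : Type*} [AddCommGroup E] {L : AddSubgroup E} {f : ι → E} :
    f ∈ piSubgroup ι L ↔ ∀ i, f i ∈ L := Iff.rfl

theorem IsTile.pi {ι : Type*} [Fintype ι] [AddCommGroup E] [MeasurableSpace E]
    {L : AddSubgroup E} {D : Set E} (h : IsTile L D) :
    IsTile (piSubgroup ι L) (Set.univ.pi fun _ : ι => D) where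
  countable := by
    have := h.countable
    refine Function.Injective.countable (f := fun (f : piSubgroup ι L) (i : ι) =>
      (⟨f.1 i, f.2 i⟩ : L)) fun f g hfg => ?_
    ext i
    exact congrArg Subtype.val (congrFun hfg i)
  measurableSet := MeasurableSet.univ_pi fun _ => h.measurableSet
  existsUnique := fun x => by
    choose g hg hu using fun i => h.existsUnique (x i)
    refine ⟨⟨fun i => g i, fun i => (g i).2⟩, fun i _ => hg i, fun f hf => ?_⟩
    ext i
    exact congrArg Subtype.val (hu i ⟨f.1 i, f.2 i⟩ (hf i trivial))

theorem IsTile.isAddFundamentalDomain [NormedAddCommGroup E] [MeasureSpace E]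
    {L : AddSubgroup E} {D : Set E} (h : IsTile L D) :
    IsAddFundamentalDomain L D (volume : Measure E) :=
  IsAddFundamentalDomain.mk' h.measurableSet.nullMeasurableSet h.existsUnique

/-- The number of points of `x + L` in the closed ball of radius `r` around `0`. -/
def cnt [NormedAddCommGroup E] (L : AddSubgroup E) (r : ℝ) (x : E) : ℝ≥0∞ :=
  ∑' p : L, (Metric.closedBall (0 : E) r).indicator 1 (x + p)

theorem cnt_mem_add [NormedAddCommGroup E] {L : AddSubgroup E} (r : ℝ) (x : E) {l : E}
    (hl : l ∈ L) : cnt L r (l + x) = cnt L r x := by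
  unfold cnt
  rw [← (Equiv.addLeft (⟨l, hl⟩ : L)).tsum_eq
    fun p : L => (Metric.closedBall (0 : E) r).indicator (1 : E → ℝ≥0∞) (x + p)]
  refine tsum_congr fun p => ?_
  congr 1
  simp only [Equiv.coe_addLeft, AddSubgroup.coe_add]
  abel

theorem cnt_le_cnt_add [NormedAddCommGroup E] {L : AddSubgroup E} {r δ : ℝ} (x : E) {y : E}
    (hy : ‖y‖ ≤ δ) : cnt L r x ≤ cnt L (r + δ) (x + y) := by
  refine ENNReal.tsum_le_tsum fun p => ?_
  by_cases hp : x + p ∈ Metric.closedBall (0 : E) r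
  · have hq : x + y + p ∈ Metric.closedBall (0 : E) (r + δ) := by
      rw [mem_closedBall_zero_iff] at hp ⊢
      calc ‖x + y + p‖ = ‖(x + p) + y‖ := by congr 1; abel
        _ ≤ r + δ := (norm_add_le _ _).trans (add_le_add hp hy)
    rw [Set.indicator_of_mem hp, Set.indicator_of_mem hq]
    exact le_rfl
  · rw [Set.indicator_of_notMem hp]
    exact zero_le

/-- Every point is within `Δ` of the subgroup `L`. -/
def CoveredBy [NormedAddCommGroup E] (L : AddSubgroup E) (Δ : ℝ) : Prop := ∀ y, ∃ l ∈ L, ‖y - l‖ ≤ Δ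

theorem CoveredBy.cnt_le [NormedAddCommGroup E] {L : AddSubgroup E} {Δ : ℝ} (hL : CoveredBy L Δ) (r : ℝ) (x y : E) :
    cnt L r x ≤ cnt L (r + Δ) (x + y) := by
  obtain ⟨l, hl, hy⟩ := hL y
  calc cnt L r x ≤ cnt L (r + Δ) (x + (y - l)) := cnt_le_cnt_add x hy
    _ = cnt L (r + Δ) (l + (x + (y - l))) := (cnt_mem_add _ _ hl).symm
    _ = cnt L (r + Δ) (x + y) := by congr 1; abel

variable [NormedAddCommGroup E] [MeasureSpace E] [BorelSpace E]
  {L : AddSubgroup E} {D : Set E}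

theorem measurable_cnt [Countable L] (r : ℝ) : Measurable (cnt L r) := by
  unfold cnt
  refine Measurable.tsum fun p => ?_
  exact (measurable_one.indicator Metric.isClosed_closedBall.measurableSet).comp
    (measurable_id.add_const _)

variable [(volume : Measure E).IsAddLeftInvariant]

theorem IsTile.setLIntegral_add (h : IsTile L D) {f : E → ℝ≥0∞}
    (hf : ∀ x, ∀ l ∈ L, f (l + x) = f x) (y : E) :
    ∫⁻ x in D, f (x + y) = ∫⁻ x in D, f x := by
  have := h.countable
  have h' : IsTile L ((fun x => x - y) ⁻¹' D) :=
    ⟨h.countable, (measurable_id.sub_const y) h.measurableSet, fun x => by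
      simpa only [Set.mem_preimage, add_sub_assoc] using h.existsUnique (x - y)⟩
  have h1 := (measurePreserving_add_right (volume : Measure E) y).setLIntegral_comp_preimage_emb
    (measurableEmbedding_addRight y) f ((fun x => x - y) ⁻¹' D)
  have h2 : (fun x => x + y) ⁻¹' ((fun x => x - y) ⁻¹' D) = D := by
    ext x; simp
  rw [h2] at h1
  rw [h1]
  exact h'.isAddFundamentalDomain.setLIntegral_eq h.isAddFundamentalDomain f
    fun g x => hf x g g.2

theorem IsTile.setLIntegral_cnt (h : IsTile L D) (r : ℝ) (x : E) :
    ∫⁻ y in D, cnt L r (x + y) = volume (Metric.closedBall (0 : E) r) := by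
  have := h.countable
  have hm : Measurable ((Metric.closedBall (0 : E) r).indicator (1 : E → ℝ≥0∞)) :=
    measurable_one.indicator Metric.isClosed_closedBall.measurableSet
  have h1 : ∫⁻ y in D, cnt L r (x + y) = ∫⁻ y in D, cnt L r y := by
    simp_rw [add_comm x]
    exact h.setLIntegral_add (fun x l hl => cnt_mem_add r x hl) x
  rw [h1]
  unfold cnt
  rw [lintegral_tsum (f := fun (p : L) y => (Metric.closedBall (0 : E) r).indicator 1 (y + p))
    fun p => (hm.comp (measurable_add_const (p : E))).aemeasurable]
  rw [← lintegral_indicator_one Metric.isClosed_closedBall.measurableSet,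
    h.isAddFundamentalDomain.lintegral_eq_tsum'']
  simp only [AddSubgroup.vadd_def, vadd_eq_add, add_comm]

variable [SecondCountableTopology E] in
theorem IsTile.lintegral_lintegral_cnt_mul {X : Type*} [MeasurableSpace X] {μ : Measure X}
    [SFinite μ] [SFinite (volume : Measure E)] (h : IsTile L D) (r : ℝ) {φ : X → E} {G : X → ℝ≥0∞}
    (hφ : Measurable φ) (hG : Measurable G) :
    ∫⁻ y in D, ∫⁻ θ, cnt L r (φ θ + y) * G θ ∂μ =
      volume (Metric.closedBall (0 : E) r) * ∫⁻ θ, G θ ∂μ := by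
  have := h.countable
  rw [lintegral_lintegral_swap, ← lintegral_const_mul _ hG]
  · refine lintegral_congr fun θ => ?_
    rw [lintegral_mul_const, h.setLIntegral_cnt]
    exact (measurable_cnt r).comp (measurable_const.add measurable_id)
  · refine Measurable.aemeasurable (Measurable.mul ?_ ?_)
    · exact (measurable_cnt r).comp ((hφ.comp measurable_snd).add measurable_fst)
    · exact hG.comp measurable_snd

theorem IsTile.volume_mul_cnt_le (h : IsTile L D) {Δ : ℝ} (hL : CoveredBy L Δ) (r : ℝ) (x : E) :
    volume D * cnt L r x ≤ volume (Metric.closedBall (0 : E) (r + Δ)) := by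
  rw [← h.setLIntegral_cnt (r + Δ) x, mul_comm, ← setLIntegral_const]
  exact lintegral_mono fun y => hL.cnt_le r x y

theorem IsTile.le_volume_mul_cnt (h : IsTile L D) {Δ : ℝ} (hL : CoveredBy L Δ) (r : ℝ) (x : E) :
    volume (Metric.closedBall (0 : E) r) ≤ volume D * cnt L (r + Δ) x := by
  rw [← h.setLIntegral_cnt r x, mul_comm, ← setLIntegral_const]
  refine lintegral_mono fun y => ?_
  simpa using hL.cnt_le r (x + y) (-y)

end Tile

section Moments

variable {m n : ℕ}

/-- The matrix-vector product of a family of rows with a vector. -/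
def app (θ : Fin m → Fin n → ℂ) (q : Fin n → ℂ) : Fin m → ℂ := fun i => ∑ j, θ i j * q j

theorem app_add (θ η : Fin m → Fin n → ℂ) (q : Fin n → ℂ) :
    app (θ + η) q = app θ q + app η q := by
  ext i
  simp [app, add_mul, Finset.sum_add_distrib]

/-- The matrix whose only nonzero column is the `j`-th one, equal to `y`. -/
def col (j : Fin n) (y : Fin m → ℂ) : Fin m → Fin n → ℂ := fun i => Pi.single j (y i)

theorem app_col (j : Fin n) (y : Fin m → ℂ) (q : Fin n → ℂ) :
    app (col j y) q = fun i => y i * q j := by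
  ext i
  simp only [app, col]
  rw [Finset.sum_eq_single j (fun k _ hk => by simp [hk]) (by simp)]
  simp

theorem continuous_app (q : Fin n → ℂ) : Continuous fun θ : Fin m → Fin n → ℂ => app θ q := by
  unfold app
  fun_prop

theorem app_mem {Λ : AddSubgroup ℂ} {q : Fin n → ℂ} (hq : ∀ j, ∀ l ∈ Λ, l * q j ∈ Λ)
    {θ : Fin m → Fin n → ℂ} (hθ : θ ∈ piSubgroup (Fin m) (piSubgroup (Fin n) Λ)) :
    app θ q ∈ piSubgroup (Fin m) Λ :=
  fun i => Λ.sum_mem fun j _ => hq j _ (hθ i j)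

theorem volume_closedBall_fin (k : ℕ) {r : ℝ} (hr : 0 ≤ r) :
    volume (Metric.closedBall (0 : Fin k → ℂ) r) = (ENNReal.ofReal r ^ 2 * ENNReal.ofReal Real.pi) ^ k := by
  rw [closedBall_pi _ hr, volume_pi_pi]
  simp [Complex.volume_closedBall, ← NNReal.coe_real_pi]

variable {Λ : AddSubgroup ℂ} {D : Set ℂ}

/-- The function `θ ↦ #{p ∈ a + Λ^m : ‖θ q + p‖ ≤ r}`. -/
def hits (Λ : AddSubgroup ℂ) (a : Fin m → ℂ) (q : Fin n → ℂ) (r : ℝ) (θ : Fin m → Fin n → ℂ) :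
    ℝ≥0∞ :=
  cnt (piSubgroup (Fin m) Λ) r (app θ q + a)

theorem hits_mem_add (a : Fin m → ℂ) {q : Fin n → ℂ} (hq : ∀ j, ∀ l ∈ Λ, l * q j ∈ Λ) (r : ℝ)
    (θ : Fin m → Fin n → ℂ) {l : Fin m → Fin n → ℂ}
    (hl : l ∈ piSubgroup (Fin m) (piSubgroup (Fin n) Λ)) :
    hits Λ a q r (l + θ) = hits Λ a q r θ := by
  unfold hits
  rw [app_add, add_assoc, cnt_mem_add _ _ (app_mem hq hl)]

theorem IsTile.measurable_hits (h : IsTile Λ D) (a : Fin m → ℂ) (q : Fin n → ℂ) (r : ℝ) :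
    Measurable (hits Λ a q r) := by
  have := (h.pi (ι := Fin m)).countable
  exact (measurable_cnt r).comp ((continuous_app q).measurable.add_const _)

theorem IsTile.lintegral_hits (h : IsTile Λ D) (a : Fin m → ℂ) {q : Fin n → ℂ}
    (hq : ∀ j, ∀ l ∈ Λ, l * q j ∈ Λ) (hq0 : q ≠ 0) (r : ℝ) :
    volume (Set.univ.pi fun _ : Fin m => D) *
        ∫⁻ θ in Set.univ.pi fun _ : Fin m => Set.univ.pi fun _ : Fin n => D, hits Λ a q r θ =
      volume (Metric.closedBall (0 : Fin m → ℂ) r) *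
        volume (Set.univ.pi fun _ : Fin m => Set.univ.pi fun _ : Fin n => D) := by
  obtain ⟨j, hj⟩ : ∃ j, q j ≠ 0 := Function.ne_iff.1 hq0
  have h1 := (h.pi (ι := Fin m)).lintegral_lintegral_cnt_mul
    (μ := volume.restrict (Set.univ.pi fun _ : Fin m => Set.univ.pi fun _ : Fin n => D)) r
    (φ := fun θ => app θ q + a) (G := 1)
    ((continuous_app q).measurable.add_const _) measurable_one
  simp only [Pi.one_apply, mul_one, lintegral_one, Measure.restrict_apply_univ] at h1
  rw [← h1, mul_comm, ← setLIntegral_const]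
  refine lintegral_congr fun y => ?_
  rw [← ((h.pi (ι := Fin n)).pi (ι := Fin m)).setLIntegral_add
    (fun x l hl => hits_mem_add a hq r x hl) (col j fun i => y i / q j)]
  refine lintegral_congr fun θ => ?_
  unfold hits
  rw [app_add, app_col]
  congr 1
  ext i
  simp [hj]
  ring

theorem IsTile.lintegral_hits_mul_hits_le (h : IsTile Λ D) (a : Fin m → ℂ) {q q' : Fin n → ℂ}
    (hq : ∀ j, ∀ l ∈ Λ, l * q j ∈ Λ) (hq' : ∀ j, ∀ l ∈ Λ, l * q' j ∈ Λ) (r r' : ℝ) {δ : ℝ}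
    (hcov : ∀ y : Fin m → ℂ, ∃ η : Fin m → Fin n → ℂ, app η q' ∈ piSubgroup (Fin m) Λ ∧
      ∃ l ∈ piSubgroup (Fin m) Λ, ‖y + l - app η q‖ ≤ δ) :
    volume (Set.univ.pi fun _ : Fin m => D) *
        ∫⁻ θ in Set.univ.pi fun _ : Fin m => Set.univ.pi fun _ : Fin n => D,
          hits Λ a q r θ * hits Λ a q' r' θ ≤
      volume (Metric.closedBall (0 : Fin m → ℂ) (r + δ)) *
        ∫⁻ θ in Set.univ.pi fun _ : Fin m => Set.univ.pi fun _ : Fin n => D,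
          hits Λ a q' r' θ := by
  rw [← (h.pi (ι := Fin m)).lintegral_lintegral_cnt_mul (r + δ) (φ := fun θ => app θ q + a)
    ((continuous_app q).measurable.add_const _) (h.measurable_hits a q' r'),
    mul_comm, ← setLIntegral_const]
  refine lintegral_mono fun y => ?_
  obtain ⟨η, hη, l, hl, hle⟩ := hcov y
  dsimp only
  rw [← ((h.pi (ι := Fin n)).pi (ι := Fin m)).setLIntegral_add (fun x l hl => by
    rw [hits_mem_add a hq r x hl, hits_mem_add a hq' r' x hl]) η]
  refine lintegral_mono fun θ => ?_
  have h2 : hits Λ a q' r' (θ + η) = hits Λ a q' r' θ := by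
    unfold hits
    rw [app_add, add_comm (app θ q'), add_assoc, cnt_mem_add _ _ hη]
  dsimp only
  rw [h2]
  gcongr
  unfold hits
  calc cnt (piSubgroup (Fin m) Λ) r (app (θ + η) q + a)
      ≤ cnt (piSubgroup (Fin m) Λ) (r + δ) (app (θ + η) q + a + (y + l - app η q)) :=
        cnt_le_cnt_add _ hle
    _ = cnt (piSubgroup (Fin m) Λ) (r + δ) (l + (app θ q + a + y)) := by
        rw [app_add]; congr 1; abel
    _ = _ := cnt_mem_add _ _ hl

end Moments

section Comparison

theorem one_add_pow_le_of_le_one (k : ℕ) {x : ℝ} (h0 : 0 ≤ x) (h1 : x ≤ 1) :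
    (1 + x) ^ k ≤ 1 + (2 ^ k - 1) * x := by
  induction k with
  | zero => simp
  | succ k ih =>
    have h2 : (1 : ℝ) ≤ 2 ^ k := one_le_pow₀ (by norm_num)
    rw [pow_succ, pow_succ]
    nlinarith [mul_le_mul_of_nonneg_right ih (by linarith : (0 : ℝ) ≤ 1 + x),
      mul_nonneg (mul_nonneg (sub_nonneg.2 h2) h0) (sub_nonneg.2 h1)]

theorem add_pow_le_mul_pow_add (k : ℕ) {r δ : ℝ} (hr : 0 ≤ r) (hδ : 0 ≤ δ) {K : ℕ} (hK : 1 ≤ K) :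
    (r + δ) ^ k ≤ (1 + 2 ^ k / K) * r ^ k + (2 * K) ^ k * δ ^ k := by
  have hK' : (1 : ℝ) ≤ K := by exact_mod_cast hK
  rcases le_total δ (r / K) with h | h
  · calc (r + δ) ^ k ≤ (r + r / K) ^ k := by gcongr
      _ = (1 + 1 / K) ^ k * r ^ k := by rw [← mul_pow]; ring
      _ ≤ (1 + (2 ^ k - 1) * (1 / K)) * r ^ k := by
        gcongr
        exact one_add_pow_le_of_le_one k (by positivity) (by rw [div_le_one] <;> linarith)
      _ ≤ (1 + 2 ^ k / K) * r ^ k := by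
        gcongr
        rw [mul_one_div]
        gcongr
        linarith
      _ ≤ _ := le_add_of_nonneg_right (by positivity)
  · rw [div_le_iff₀ (by linarith)] at h
    calc (r + δ) ^ k ≤ ((2 * K) * δ) ^ k := by gcongr; nlinarith
      _ = (2 * K) ^ k * δ ^ k := mul_pow _ _ _
      _ ≤ _ := le_add_of_nonneg_left (by positivity)

theorem ofReal_add_pow_le (k : ℕ) {r δ : ℝ} (hr : 0 ≤ r) (hδ : 0 ≤ δ) {K : ℕ} (hK : 1 ≤ K) :
    ENNReal.ofReal (r + δ) ^ k ≤ (1 + 2 ^ k / K) * ENNReal.ofReal r ^ k +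
      (2 * K) ^ k * ENNReal.ofReal δ ^ k := by
  have hK' : (0 : ℝ) < K := by exact_mod_cast hK
  have h := ENNReal.ofReal_le_ofReal (add_pow_le_mul_pow_add k hr hδ hK)
  rw [ENNReal.ofReal_pow (by positivity), ENNReal.ofReal_add (p := _ * _) (by positivity)
      (by positivity), ENNReal.ofReal_mul (by positivity), ENNReal.ofReal_mul (by positivity),
    ENNReal.ofReal_add (p := 1) (by positivity) (by positivity), ENNReal.ofReal_div_of_pos hK',
    ENNReal.ofReal_pow hr, ENNReal.ofReal_pow hδ, ENNReal.ofReal_pow (by positivity),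
    ENNReal.ofReal_pow (by positivity), ENNReal.ofReal_mul (by positivity)] at h
  simpa using h

/-- Integrals of a decreasing function against two measures on `[1, T)` are compared through the
measures of initial intervals. -/
theorem lintegral_antitone_le {ν₁ ν₂ : Measure ℝ} {ψ : ℝ → ℝ} (hψ : AntitoneOn ψ (Set.Ici 1))
    (hpos : ∀ t, 1 ≤ t → 0 < ψ t) {a b : ℝ≥0∞}
    (hν : ∀ τ, 1 ≤ τ → ν₁ (Set.Icc 1 τ) ≤ a * ν₂ (Set.Ico 1 τ) + b) (T : ℝ) :
    ∫⁻ t in Set.Ico 1 T, ENNReal.ofReal (ψ t) ∂ν₁ ≤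
      a * (∫⁻ t in Set.Ico 1 T, ENNReal.ofReal (ψ t) ∂ν₂) + b * ENNReal.ofReal (ψ 1) := by
  have hIco : MeasurableSet (Set.Ico 1 T) := measurableSet_Ico
  have key (ν : Measure ℝ) : ∫⁻ t in Set.Ico 1 T, ENNReal.ofReal (ψ t) ∂ν =
      ∫⁻ u in Set.Ioi 0, (ν.restrict (Set.Ico 1 T)) {t | u < ψ t} := by
    refine lintegral_eq_lintegral_meas_lt _ ?_ ?_
    · filter_upwards [ae_restrict_mem hIco] with t ht using (hpos t ht.1).le
    · exact aemeasurable_restrict_of_antitoneOn hIco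
        (hψ.mono fun t ht => ht.1)
  have hmeas (ν : Measure ℝ) : Measurable fun u : ℝ => ν {t | u < ψ t} :=
    Antitone.measurable fun u u' huu' => measure_mono fun t ht => lt_of_le_of_lt huu' ht
  rw [key, key]
  calc ∫⁻ u in Set.Ioi 0, (ν₁.restrict (Set.Ico 1 T)) {t | u < ψ t}
      ≤ ∫⁻ u in Set.Ioi (0 : ℝ), (a * (ν₂.restrict (Set.Ico 1 T)) {t | u < ψ t} +
          (Set.Iio (ψ 1)).indicator (fun _ => b) u) := by
        refine lintegral_mono fun u => ?_
        rw [Measure.restrict_apply' hIco, Measure.restrict_apply' hIco]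
        set S := {t | u < ψ t} ∩ Set.Ico 1 T with hS
        rcases S.eq_empty_or_nonempty with h | ⟨s, hs⟩
        · simp [h]
        · have hu : u ∈ Set.Iio (ψ 1) :=
            lt_of_lt_of_le hs.1 (hψ (Set.mem_Ici.2 le_rfl) hs.2.1 hs.2.1)
          have hbdd : BddAbove S := ⟨T, fun t ht => ht.2.2.le⟩
          rw [Set.indicator_of_mem hu]
          calc ν₁ S ≤ ν₁ (Set.Icc 1 (sSup S)) :=
                measure_mono fun t ht => ⟨ht.2.1, le_csSup hbdd ht⟩
            _ ≤ a * ν₂ (Set.Ico 1 (sSup S)) + b := hν _ (hs.2.1.trans (le_csSup hbdd hs))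
            _ ≤ a * ν₂ S + b := by
              gcongr
              intro t ht
              obtain ⟨x, hx, htx⟩ := exists_lt_of_lt_csSup ⟨s, hs⟩ ht.2
              exact ⟨lt_of_lt_of_le hx.1 (hψ ht.1 hx.2.1 htx.le), ht.1, htx.trans hx.2.2⟩
    _ = a * (∫⁻ u in Set.Ioi 0, (ν₂.restrict (Set.Ico 1 T)) {t | u < ψ t}) +
          b * ENNReal.ofReal (ψ 1) := by
        rw [lintegral_add_right _ (measurable_const.indicator measurableSet_Iio),
          lintegral_const_mul _ (hmeas _), lintegral_indicator measurableSet_Iio,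
          Measure.restrict_restrict measurableSet_Iio, setLIntegral_const,
          Set.inter_comm, Set.Ioi_inter_Iio, Real.volume_Ioo, sub_zero]

/-- The weight `ψ` cut off to `[1, T)`. -/
def weight (ψ : ℝ → ℝ) (T t : ℝ) : ℝ≥0∞ :=
  (Set.Ico 1 T).indicator (fun t => ENNReal.ofReal (ψ t)) t

theorem lintegral_sum_dirac {I : Type*} [Countable I] (s : I → ℝ) (ψ : ℝ → ℝ) (T : ℝ) :
    ∫⁻ t in Set.Ico 1 T, ENNReal.ofReal (ψ t) ∂(Measure.sum fun i => Measure.dirac (s i)) =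
      ∑' i, weight ψ T (s i) := by
  rw [← lintegral_indicator measurableSet_Ico, lintegral_sum_measure]
  refine tsum_congr fun i => ?_
  rw [lintegral_dirac]
  rfl

theorem sum_dirac_apply {I : Type*} (s : I → ℝ) {A : Set ℝ} (hA : MeasurableSet A) :
    (Measure.sum fun i => Measure.dirac (s i)) A = ∑' i, A.indicator 1 (s i) := by
  rw [Measure.sum_apply _ hA]
  exact tsum_congr fun i => Measure.dirac_apply' _ hA

theorem lintegral_weight_of_antitoneOn {ψ : ℝ → ℝ} (hψ : AntitoneOn ψ (Set.Ici 1))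
    (hpos : ∀ t, 1 ≤ t → 0 < ψ t) {T : ℝ} (hT : 1 ≤ T) :
    ∫⁻ t in Set.Ico 1 T, ENNReal.ofReal (ψ t) = ENNReal.ofReal (∫ t in (1 : ℝ)..T, ψ t) := by
  have hint : IntervalIntegrable ψ volume 1 T := by
    refine AntitoneOn.intervalIntegrable (hψ.mono fun t ht => ?_)
    rw [Set.uIcc_of_le hT] at ht
    exact ht.1
  rw [intervalIntegral.integral_of_le hT, ofReal_integral_eq_lintegral_ofReal hint.1,
    setLIntegral_congr Ico_ae_eq_Ioc]
  filter_upwards [ae_restrict_mem measurableSet_Ioc] with t ht using (hpos t ht.1.le).le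

end Comparison

section Counting

variable {n : ℕ}

theorem CoveredBy.pi {Λ : AddSubgroup ℂ} {Δ : ℝ} (hΔ : 0 ≤ Δ) (h : CoveredBy Λ Δ) (k : ℕ) :
    CoveredBy (piSubgroup (Fin k) Λ) Δ := fun y => by
  choose l hl hle using h
  exact ⟨fun i => l (y i), fun i => hl (y i), (pi_norm_le_iff_of_nonneg hΔ).2 fun i => hle (y i)⟩

theorem exists_pow_eq (hn : 1 ≤ n) {τ : ℝ} (hτ : 0 ≤ τ) : ∃ R : ℝ, 0 ≤ R ∧ R ^ (2 * n) = τ :=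
  ⟨τ ^ (((2 * n : ℕ) : ℝ)⁻¹), by positivity, Real.rpow_inv_natCast_pow hτ (by omega)⟩

theorem volume_closedBall_fin' (k : ℕ) {r : ℝ} (hr : 0 ≤ r) :
    volume (Metric.closedBall (0 : Fin k → ℂ) r) =
      ENNReal.ofReal Real.pi ^ k * ENNReal.ofReal r ^ (2 * k) := by
  rw [volume_closedBall_fin k hr, mul_pow, ← pow_mul, mul_comm]

theorem volume_ball_fin (k : ℕ) (x : Fin k → ℂ) {r : ℝ} (hr : 0 < r) :
    volume (Metric.ball x r) = ENNReal.ofReal Real.pi ^ k * ENNReal.ofReal r ^ (2 * k) := by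
  rw [ball_pi _ hr, volume_pi_pi]
  simp [Complex.volume_ball, ← NNReal.coe_real_pi, Finset.prod_const, mul_pow, ← pow_mul, mul_comm]

theorem ofReal_pow_eq {R τ : ℝ} (hR : 0 ≤ R) {k : ℕ} (h : R ^ k = τ) :
    ENNReal.ofReal R ^ k = ENNReal.ofReal τ := by
  rw [← h, ENNReal.ofReal_pow hR]

theorem ofReal_eq_volume_Ico_add {τ : ℝ} (hτ : 1 ≤ τ) :
    ENNReal.ofReal τ = volume (Set.Ico 1 τ) + 1 := by
  rw [Real.volume_Ico, ← ENNReal.ofReal_one, ← ENNReal.ofReal_add (by linarith) zero_le_one]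
  congr 1
  ring

theorem lintegral_smul_sum_dirac {I : Type*} [Countable I] (s : I → ℝ) (ψ : ℝ → ℝ) (T : ℝ)
    (c : ℝ≥0∞) :
    ∫⁻ t in Set.Ico 1 T, ENNReal.ofReal (ψ t) ∂(c • Measure.sum fun i => Measure.dirac (s i)) =
      c * ∑' i, weight ψ T (s i) := by
  rw [Measure.restrict_smul, lintegral_smul_measure, lintegral_sum_dirac, smul_eq_mul]

variable {Λ : AddSubgroup ℂ} {D : Set ℂ} {Δ : ℝ} {ψ : ℝ → ℝ}

theorem volume_mul_tsum_weight_le (h : IsTile Λ D) (hΔ : 0 ≤ Δ) (hcov : CoveredBy Λ Δ)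
    (hn : 1 ≤ n) (w : Fin n → ℂ) (hψ : AntitoneOn ψ (Set.Ici 1))
    (hpos : ∀ t, 1 ≤ t → 0 < ψ t) {K : ℕ} (hK : 1 ≤ K) :
    ∃ C : ℝ≥0∞, C ≠ ⊤ ∧ ∀ T, volume D ^ n *
        ∑' l : piSubgroup (Fin n) Λ, weight ψ T (‖w + l‖ ^ (2 * n)) ≤
      ENNReal.ofReal Real.pi ^ n * (1 + 2 ^ (2 * n) / K) *
        (∫⁻ t in Set.Ico 1 T, ENNReal.ofReal (ψ t)) + C := by
  have := (h.pi (ι := Fin n)).countable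
  have hKt : (2 : ℝ≥0∞) ^ (2 * n) / K ≠ ⊤ :=
    ENNReal.div_ne_top (by simp) (by simp; omega)
  refine ⟨(ENNReal.ofReal Real.pi ^ n * (1 + 2 ^ (2 * n) / K) + ENNReal.ofReal Real.pi ^ n *
    ((2 * K) ^ (2 * n) * ENNReal.ofReal Δ ^ (2 * n))) * ENNReal.ofReal (ψ 1), ?_, fun T => ?_⟩
  · finiteness
  rw [← lintegral_smul_sum_dirac]
  refine lintegral_antitone_le hψ hpos (fun τ hτ => ?_) T
  obtain ⟨R, hR, hRτ⟩ := exists_pow_eq hn (zero_le_one.trans hτ)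
  rw [Measure.smul_apply, sum_dirac_apply _ measurableSet_Icc, smul_eq_mul]
  calc volume D ^ n * ∑' l : piSubgroup (Fin n) Λ,
        (Set.Icc 1 τ).indicator (1 : ℝ → ℝ≥0∞) (‖w + l‖ ^ (2 * n))
      ≤ volume D ^ n * cnt (piSubgroup (Fin n) Λ) R w := by
        gcongr
        unfold cnt
        gcongr with l
        by_cases ht : ‖w + l‖ ^ (2 * n) ∈ Set.Icc 1 τ
        · rw [Set.indicator_of_mem ht, Set.indicator_of_mem]
          · rfl
          · rw [mem_closedBall_zero_iff]
            exact (pow_le_pow_iff_left₀ (norm_nonneg _) hR (by omega)).1 (ht.2.trans hRτ.ge)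
        · rw [Set.indicator_of_notMem ht]
          exact zero_le
    _ ≤ volume (Metric.closedBall (0 : Fin n → ℂ) (R + Δ)) := by
        simpa [volume_pi_pi] using (h.pi (ι := Fin n)).volume_mul_cnt_le (hcov.pi hΔ n) R w
    _ ≤ ENNReal.ofReal Real.pi ^ n * ((1 + 2 ^ (2 * n) / K) * ENNReal.ofReal R ^ (2 * n) +
          (2 * K) ^ (2 * n) * ENNReal.ofReal Δ ^ (2 * n)) := by
        rw [volume_closedBall_fin' n (by positivity)]
        gcongr
        exact ofReal_add_pow_le _ hR hΔ hK
    _ = _ := by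
        rw [ofReal_pow_eq hR hRτ, ofReal_eq_volume_Ico_add hτ]
        ring

theorem lintegral_le_volume_mul_tsum_weight (h : IsTile Λ D) (hΔ : 0 ≤ Δ) (hcov : CoveredBy Λ Δ)
    (hn : 1 ≤ n) (w : Fin n → ℂ) (hψ : AntitoneOn ψ (Set.Ici 1))
    (hpos : ∀ t, 1 ≤ t → 0 < ψ t) {K : ℕ} (hK : 1 ≤ K) :
    ∃ C : ℝ≥0∞, C ≠ ⊤ ∧ ∀ T, ENNReal.ofReal Real.pi ^ n *
        (∫⁻ t in Set.Ico 1 T, ENNReal.ofReal (ψ t)) ≤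
      (1 + 2 ^ (2 * n) / K) * (volume D ^ n *
        ∑' l : piSubgroup (Fin n) Λ, weight ψ T (‖w + l‖ ^ (2 * n))) + C := by
  have := (h.pi (ι := Fin n)).countable
  have hKt : (2 : ℝ≥0∞) ^ (2 * n) / K ≠ ⊤ :=
    ENNReal.div_ne_top (by simp) (by simp; omega)
  set P := ENNReal.ofReal Real.pi ^ n with hP
  have hPt : P ≠ ⊤ := by finiteness
  set B := volume (Metric.closedBall (0 : Fin n → ℂ) (1 + Δ)) with hB
  have hBt : B ≠ ⊤ := measure_closedBall_lt_top.ne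
  refine ⟨((1 + 2 ^ (2 * n) / K) * B + P * ((2 * K) ^ (2 * n) * ENNReal.ofReal (1 + Δ) ^ (2 * n))) *
    ENNReal.ofReal (ψ 1), by finiteness, fun T => ?_⟩
  have e1 : P * (∫⁻ t in Set.Ico 1 T, ENNReal.ofReal (ψ t)) =
      ∫⁻ t in Set.Ico 1 T, ENNReal.ofReal (ψ t) ∂(P • volume) := by
    rw [Measure.restrict_smul, lintegral_smul_measure, smul_eq_mul]
  rw [← lintegral_smul_sum_dirac, e1]
  refine lintegral_antitone_le hψ hpos (fun τ hτ => ?_) T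
  obtain ⟨R, hR, hRτ⟩ := exists_pow_eq hn (zero_le_one.trans hτ)
  rw [Measure.smul_apply, Measure.smul_apply, sum_dirac_apply _ measurableSet_Ico, smul_eq_mul,
    smul_eq_mul]
  have e2 : P * volume (Set.Icc 1 τ) ≤ P * ENNReal.ofReal R ^ (2 * n) := by
    rw [ofReal_pow_eq hR hRτ, Real.volume_Icc]
    gcongr
    linarith
  refine e2.trans ?_
  rcases le_total (1 + Δ) R with hRΔ | hRΔ
  · have e3 : P * ENNReal.ofReal (R - (1 + Δ)) ^ (2 * n) ≤ volume D ^ n * (∑' l : piSubgroup (Fin n) Λ,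
        (Set.Ico 1 τ).indicator (1 : ℝ → ℝ≥0∞) (‖w + l‖ ^ (2 * n))) + B := by
      rw [← volume_closedBall_fin' n (sub_nonneg.2 hRΔ)]
      calc volume (Metric.closedBall (0 : Fin n → ℂ) (R - (1 + Δ)))
          ≤ volume D ^ n * cnt (piSubgroup (Fin n) Λ) (R - 1) w := by
            have := (h.pi (ι := Fin n)).le_volume_mul_cnt (hcov.pi hΔ n) (R - (1 + Δ)) w
            rw [show R - (1 + Δ) + Δ = R - 1 by ring] at this
            simpa [volume_pi_pi] using this
        _ ≤ volume D ^ n * ((∑' l : piSubgroup (Fin n) Λ,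
            (Set.Ico 1 τ).indicator (1 : ℝ → ℝ≥0∞) (‖w + l‖ ^ (2 * n))) +
              cnt (piSubgroup (Fin n) Λ) 1 w) := by
            gcongr
            unfold cnt
            rw [← ENNReal.tsum_add]
            gcongr with l
            by_cases hl : w + (l : Fin n → ℂ) ∈ Metric.closedBall (0 : Fin n → ℂ) (R - 1)
            · rw [Set.indicator_of_mem hl]
              rw [mem_closedBall_zero_iff] at hl
              rcases le_or_gt ‖w + (l : Fin n → ℂ)‖ 1 with h1 | h1
              · rw [Set.indicator_of_mem (s := Metric.closedBall _ 1)
                  (mem_closedBall_zero_iff.2 h1)]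
                exact le_add_self
              · rw [Set.indicator_of_mem (s := Set.Ico 1 τ)
                  ⟨one_le_pow₀ h1.le, hRτ ▸ pow_lt_pow_left₀ (by linarith) (norm_nonneg _)
                    (by omega)⟩]
                exact le_self_add
            · rw [Set.indicator_of_notMem hl]
              exact zero_le
        _ ≤ _ := by
            rw [mul_add]
            gcongr
            simpa [volume_pi_pi] using (h.pi (ι := Fin n)).volume_mul_cnt_le (hcov.pi hΔ n) 1 w
    calc P * ENNReal.ofReal R ^ (2 * n)
        = P * ENNReal.ofReal ((R - (1 + Δ)) + (1 + Δ)) ^ (2 * n) := by ring_nf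
      _ ≤ P * ((1 + 2 ^ (2 * n) / K) * ENNReal.ofReal (R - (1 + Δ)) ^ (2 * n) +
            (2 * K) ^ (2 * n) * ENNReal.ofReal (1 + Δ) ^ (2 * n)) := by
          gcongr
          exact ofReal_add_pow_le _ (sub_nonneg.2 hRΔ) (by linarith) hK
      _ = (1 + 2 ^ (2 * n) / K) * (P * ENNReal.ofReal (R - (1 + Δ)) ^ (2 * n)) +
            P * ((2 * K) ^ (2 * n) * ENNReal.ofReal (1 + Δ) ^ (2 * n)) := by ring
      _ ≤ _ := by
          grw [e3]
          apply le_of_eq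
          ring
  · calc P * ENNReal.ofReal R ^ (2 * n) ≤ P * (1 * ENNReal.ofReal (1 + Δ) ^ (2 * n)) := by
          rw [one_mul]; gcongr
      _ ≤ P * ((2 * K) ^ (2 * n) * ENNReal.ofReal (1 + Δ) ^ (2 * n)) := by
          gcongr
          exact one_le_pow₀ (by exact_mod_cast (by omega : 1 ≤ 2 * K))
      _ ≤ _ := by rw [← add_assoc]; exact le_add_self

end Counting

section Packing

variable {n : ℕ} {ψ : ℝ → ℝ}

theorem tsum_indicator_closedBall_mul_le {I : Type*} [Countable I] (q : I → Fin n → ℂ) {β : ℝ}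
    (hβ : 0 < β) (hsep : ∀ i j, i ≠ j → β ≤ ‖q i - q j‖) (hq : ∀ i, β ≤ ‖q i‖) {R : ℝ}
    (hR : 0 ≤ R) :
    (∑' i, (Metric.closedBall 0 R).indicator (1 : (Fin n → ℂ) → ℝ≥0∞) (q i)) *
      ENNReal.ofReal β ^ (2 * n) ≤ 9 ^ n * ENNReal.ofReal R ^ (2 * n) := by
  classical
  set A : I → Set (Fin n → ℂ) := fun i => if ‖q i‖ ≤ R then Metric.ball (q i) (β / 2) else ∅
  have hA : ∀ i, MeasurableSet (A i) := fun i => by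
    unfold A
    split_ifs
    exacts [measurableSet_ball, MeasurableSet.empty]
  have hdisj : Pairwise (Function.onFun Disjoint A) := fun i j hij => by
    simp only [Function.onFun, A]
    split_ifs <;> try simp
    refine Metric.ball_disjoint_ball ?_
    rw [dist_eq_norm]
    linarith [hsep i j hij]
  have hsub : ⋃ i, A i ⊆ Metric.closedBall 0 (3 / 2 * R) := Set.iUnion_subset fun i x hx => by
    simp only [A] at hx
    split_ifs at hx with h
    · rw [mem_closedBall_zero_iff]
      rw [mem_ball_iff_norm] at hx
      have := norm_le_norm_add_norm_sub' x (q i)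
      linarith [hq i]
    · exact hx.elim
  have h1 : ∑' i, volume (A i) ≤ volume (Metric.closedBall (0 : Fin n → ℂ) (3 / 2 * R)) := by
    rw [← measure_iUnion hdisj hA]
    exact measure_mono hsub
  have h2 (i : I) : volume (A i) = (Metric.closedBall 0 R).indicator (1 : (Fin n → ℂ) → ℝ≥0∞) (q i)
      * (ENNReal.ofReal Real.pi ^ n * ENNReal.ofReal (β / 2) ^ (2 * n)) := by
    simp only [A]
    split_ifs with h
    · rw [volume_ball_fin n _ (by positivity), Set.indicator_of_mem (by simpa using h)]
      simp
    · rw [Set.indicator_of_notMem (by simpa using h)]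
      simp
  simp only [h2] at h1
  rw [ENNReal.tsum_mul_right, volume_closedBall_fin' n (by positivity), mul_left_comm] at h1
  have hpi : ENNReal.ofReal Real.pi ^ n ≠ 0 := by simp [Real.pi_pos]
  have h3 := (ENNReal.mul_le_mul_iff_right hpi (by finiteness)).1 h1
  have e1 : ENNReal.ofReal β ^ (2 * n) = 4 ^ n * ENNReal.ofReal (β / 2) ^ (2 * n) := by
    rw [pow_mul, pow_mul, ← mul_pow]
    congr 1
    rw [← ENNReal.ofReal_pow hβ.le, ← ENNReal.ofReal_pow (by positivity),
      ← ENNReal.ofReal_ofNat, ← ENNReal.ofReal_mul (by norm_num)]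
    congr 1
    ring
  have e2 : (9 : ℝ≥0∞) ^ n * ENNReal.ofReal R ^ (2 * n) =
      4 ^ n * ENNReal.ofReal (3 / 2 * R) ^ (2 * n) := by
    rw [pow_mul, pow_mul, ← mul_pow, ← mul_pow]
    congr 1
    rw [← ENNReal.ofReal_pow hR, ← ENNReal.ofReal_pow (by positivity),
      ← ENNReal.ofReal_ofNat, ← ENNReal.ofReal_ofNat (n := 4), ← ENNReal.ofReal_mul (by norm_num),
      ← ENNReal.ofReal_mul (by norm_num)]
    congr 1
    ring
  rw [e1, e2, mul_left_comm]
  gcongr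

theorem tsum_weight_mul_le {I : Type*} [Countable I] (hn : 1 ≤ n) (q : I → Fin n → ℂ) {β : ℝ}
    (hβ : 0 < β) (hsep : ∀ i j, i ≠ j → β ≤ ‖q i - q j‖) (hq : ∀ i, β ≤ ‖q i‖)
    (hψ : AntitoneOn ψ (Set.Ici 1)) (hpos : ∀ t, 1 ≤ t → 0 < ψ t) (T : ℝ) :
    ENNReal.ofReal β ^ (2 * n) * ∑' i, weight ψ T (‖q i‖ ^ (2 * n)) ≤
      9 ^ n * (∫⁻ t in Set.Ico 1 T, ENNReal.ofReal (ψ t)) + 9 ^ n * ENNReal.ofReal (ψ 1) := by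
  rw [← lintegral_smul_sum_dirac]
  refine lintegral_antitone_le hψ hpos (fun τ hτ => ?_) T
  obtain ⟨R, hR, hRτ⟩ := exists_pow_eq hn (zero_le_one.trans hτ)
  rw [Measure.smul_apply, sum_dirac_apply _ measurableSet_Icc, smul_eq_mul]
  calc ENNReal.ofReal β ^ (2 * n) *
        ∑' i, (Set.Icc 1 τ).indicator (1 : ℝ → ℝ≥0∞) (‖q i‖ ^ (2 * n))
      ≤ ENNReal.ofReal β ^ (2 * n) *
        ∑' i, (Metric.closedBall 0 R).indicator (1 : (Fin n → ℂ) → ℝ≥0∞) (q i) := by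
        gcongr with i
        by_cases ht : ‖q i‖ ^ (2 * n) ∈ Set.Icc 1 τ
        · rw [Set.indicator_of_mem ht, Set.indicator_of_mem]
          · rfl
          · rw [mem_closedBall_zero_iff]
            exact (pow_le_pow_iff_left₀ (norm_nonneg _) hR (by omega)).1 (ht.2.trans hRτ.ge)
        · rw [Set.indicator_of_notMem ht]
          exact zero_le
    _ ≤ 9 ^ n * ENNReal.ofReal R ^ (2 * n) := by
        rw [mul_comm]
        exact tsum_indicator_closedBall_mul_le q hβ hsep hq hR
    _ = _ := by
        rw [ofReal_pow_eq hR hRτ, ofReal_eq_volume_Ico_add hτ, mul_add, mul_one]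

theorem tsum_indicator_ball_le {I : Type*} [Countable I] (z : I → ℂ)
    (hsep : ∀ i j, i ≠ j → 1 ≤ ‖z i - z j‖) (hz : ∀ i, 1 ≤ ‖z i‖) {R : ℝ} (hR : 0 ≤ R) :
    ∑' i, (Metric.closedBall 0 R).indicator (1 : ℂ → ℝ≥0∞) (z i) ≤ 9 * ENNReal.ofReal R ^ 2 := by
  have hconst (x : ℂ) : ‖(fun _ : Fin 1 => x)‖ = ‖x‖ := pi_norm_const x
  have := tsum_indicator_closedBall_mul_le (fun i (_ : Fin 1) => z i) one_pos
    (fun i j hij => (hsep i j hij).trans_eq (hconst (z i - z j)).symm)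
    (fun i => (hz i).trans_eq (hconst _).symm) hR
  have e (i : I) : (Metric.closedBall 0 R).indicator (1 : (Fin 1 → ℂ) → ℝ≥0∞) (fun _ => z i) =
      (Metric.closedBall 0 R).indicator (1 : ℂ → ℝ≥0∞) (z i) := by
    classical
    simp only [Set.indicator_apply, mem_closedBall_zero_iff, hconst]
    rfl
  simp only [e] at this
  simpa using this

theorem tsum_inv_norm_pow_le {I : Type*} [Countable I] (z : I → ℂ)
    (hsep : ∀ i j, i ≠ j → 1 ≤ ‖z i - z j‖) (hz : ∀ i, 1 ≤ ‖z i‖) :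
    ∑' i, ENNReal.ofReal (‖z i‖⁻¹ ^ 4) ≤ 18 := by
  have hconst (x : ℂ) : ‖(fun _ : Fin 1 => x)‖ = ‖x‖ := pi_norm_const x
  rw [ENNReal.tsum_eq_iSup_sum]
  refine iSup_le fun s => ?_
  set T : ℝ := 1 + ∑ i ∈ s, ‖z i‖ ^ 2
  have hT1 : 1 ≤ T := le_add_of_nonneg_right (by positivity)
  have hdec : AntitoneOn (fun t : ℝ => (t ^ 2)⁻¹) (Set.Ici 1) := fun x hx y hy hxy => by
    have : (1 : ℝ) ≤ x := hx
    simp only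
    gcongr
  have := tsum_weight_mul_le (n := 1) le_rfl (ψ := fun t => (t ^ 2)⁻¹) (fun i _ => z i) one_pos
    (fun i j hij => (hsep i j hij).trans_eq (hconst (z i - z j)).symm)
    (fun i => (hz i).trans_eq (hconst _).symm) hdec (fun t ht => by positivity) T
  rw [lintegral_weight_of_antitoneOn hdec (fun t ht => by positivity) hT1] at this
  have hint : ∫ t in (1 : ℝ)..T, (t ^ 2)⁻¹ ≤ 1 := by
    have h0 : (0 : ℝ) ∉ Set.uIcc 1 T := by
      rw [Set.uIcc_of_le hT1]
      simp
    have := integral_zpow (a := 1) (b := T) (n := -2) (Or.inr ⟨by norm_num, h0⟩)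
    have e : ∫ t in (1 : ℝ)..T, (t ^ 2)⁻¹ = ∫ t in (1 : ℝ)..T, t ^ (-2 : ℤ) := by
      simp [zpow_neg]
    rw [e, this]
    have : 0 < T⁻¹ := by positivity
    norm_num
    linarith
  calc ∑ i ∈ s, ENNReal.ofReal (‖z i‖⁻¹ ^ 4)
      = ∑ i ∈ s, weight (fun t => (t ^ 2)⁻¹) T (‖z i‖ ^ 2) := by
        refine Finset.sum_congr rfl fun i hi => ?_
        rw [weight, Set.indicator_of_mem]
        · congr 1
          ring
        · refine ⟨one_le_pow₀ (hz i), ?_⟩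
          have := Finset.single_le_sum (f := fun i => ‖z i‖ ^ 2) (fun i _ => by positivity) hi
          linarith
    _ ≤ ∑' i, weight (fun t => (t ^ 2)⁻¹) T (‖z i‖ ^ 2) := ENNReal.sum_le_tsum _
    _ ≤ 9 * ENNReal.ofReal (∫ t in (1 : ℝ)..T, (t ^ 2)⁻¹) + 9 := by
        simpa [hconst] using this
    _ ≤ 9 * ENNReal.ofReal 1 + 9 := by gcongr
    _ = 18 := by norm_num

end Packing

section Volume

variable {m n : ℕ} {ψ : ℝ → ℝ}

theorem cnorm_eq_norm_sq {k : Type*} [Fintype k] (x : k → ℂ) : cnorm x = ‖x‖ ^ 2 := by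
  have hbdd : BddAbove (Set.range fun i => Complex.normSq (x i)) := Set.finite_range _ |>.bddAbove
  have h0 : 0 ≤ cnorm x := Real.iSup_nonneg fun i => Complex.normSq_nonneg _
  apply le_antisymm
  · refine Real.iSup_le (fun i => ?_) (by positivity)
    rw [Complex.normSq_eq_norm_sq]
    gcongr
    exact norm_le_pi_norm x i
  · rw [← Real.le_sqrt (norm_nonneg _) h0, pi_norm_le_iff_of_nonneg (Real.sqrt_nonneg _)]
    intro i
    rw [Real.le_sqrt (norm_nonneg _) h0, ← Complex.normSq_eq_norm_sq]
    exact le_ciSup hbdd i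

/-- The radius of the ball `‖x‖ ^ (2 * m) ≤ ψ t`. -/
def radius (m : ℕ) (ψ : ℝ → ℝ) (t : ℝ) : ℝ := ψ t ^ (((2 * m : ℕ) : ℝ)⁻¹)

theorem radius_nonneg {t : ℝ} (h : 0 ≤ ψ t) : 0 ≤ radius m ψ t := Real.rpow_nonneg h _

theorem radius_pow (hm : 1 ≤ m) {t : ℝ} (h : 0 ≤ ψ t) : radius m ψ t ^ (2 * m) = ψ t :=
  Real.rpow_inv_natCast_pow h (by omega)

theorem norm_le_radius_iff {E : Type*} [SeminormedAddGroup E] (hm : 1 ≤ m) {t : ℝ} (h : 0 ≤ ψ t)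
    (x : E) : ‖x‖ ≤ radius m ψ t ↔ ‖x‖ ^ (2 * m) ≤ ψ t := by
  rw [← pow_le_pow_iff_left₀ (norm_nonneg x) (radius_nonneg h) (n := 2 * m) (by omega),
    radius_pow hm h]

theorem volume_closedBall_radius (hm : 1 ≤ m) {t : ℝ} (h : 0 ≤ ψ t) :
    volume (Metric.closedBall (0 : Fin m → ℂ) (radius m ψ t)) =
      ENNReal.ofReal Real.pi ^ m * ENNReal.ofReal (ψ t) := by
  rw [volume_closedBall_fin' m (radius_nonneg h), ofReal_pow_eq (radius_nonneg h) (radius_pow hm h)]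

theorem mem_Einf_iff {T : ℝ} (z : (Fin m → ℂ) × (Fin n → ℂ)) : z ∈ Einf m n ψ T ↔
    ‖z.1‖ ^ (2 * m) ≤ ψ (‖z.2‖ ^ (2 * n)) ∧ ‖z.2‖ ^ (2 * n) ∈ Set.Ico 1 T := by
  simp only [Einf, cnorm_eq_norm_sq, ← pow_mul]
  rfl

theorem measurable_comp_max (hψ : AntitoneOn ψ (Set.Ici 1)) : Measurable fun t => ψ (max t 1) :=
  Antitone.measurable fun _ _ h =>
    hψ (Set.mem_Ici.2 (le_max_right _ _)) (Set.mem_Ici.2 (le_max_right _ _)) (max_le_max_right _ h)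

theorem measurable_weight (hψ : AntitoneOn ψ (Set.Ici 1)) (T : ℝ) : Measurable (weight ψ T) := by
  have : weight ψ T = (Set.Ico 1 T).indicator fun t => ENNReal.ofReal (ψ (max t 1)) := by
    refine Set.indicator_congr fun t ht => ?_
    rw [max_eq_left ht.1]
  rw [this]
  exact (measurable_comp_max hψ).ennreal_ofReal.indicator measurableSet_Ico

theorem measurableSet_Einf (hψ : AntitoneOn ψ (Set.Ici 1)) (T : ℝ) :
    MeasurableSet (Einf m n ψ T) := by
  have : Einf m n ψ T = {z | ‖z.1‖ ^ (2 * m) ≤ ψ (max (‖z.2‖ ^ (2 * n)) 1)} ∩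
      {z | ‖z.2‖ ^ (2 * n) ∈ Set.Ico 1 T} := by
    ext z
    rw [mem_Einf_iff]
    refine and_congr_left fun h => ?_
    rw [Set.mem_ofPred_eq, max_eq_left h.1]
  rw [this]
  refine (measurableSet_le (by fun_prop) ((measurable_comp_max hψ).comp (by fun_prop))).inter ?_
  exact measurableSet_Ico.preimage (by fun_prop)

theorem volume_Einf (hm : 1 ≤ m) (hψ : AntitoneOn ψ (Set.Ici 1)) (hpos : ∀ t, 1 ≤ t → 0 < ψ t)
    (T : ℝ) : volume (Einf m n ψ T) = ENNReal.ofReal Real.pi ^ m *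
      ∫⁻ t in Set.Ico 1 T, ENNReal.ofReal (ψ t)
        ∂(Measure.map (fun y : Fin n → ℂ => ‖y‖ ^ (2 * n)) volume) := by
  rw [← lintegral_indicator measurableSet_Ico]
  change _ = _ * ∫⁻ t, weight ψ T t ∂_
  rw [lintegral_map (measurable_weight hψ T) (by fun_prop),
    ← lintegral_const_mul (f := fun y : Fin n → ℂ => weight ψ T (‖y‖ ^ (2 * n))) _
      ((measurable_weight hψ T).comp (by fun_prop))]
  rw [show (volume : Measure ((Fin m → ℂ) × (Fin n → ℂ))) = volume.prod volume from rfl,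
    Measure.prod_apply_symm (measurableSet_Einf hψ T)]
  refine lintegral_congr fun y => ?_
  by_cases hy : ‖y‖ ^ (2 * n) ∈ Set.Ico 1 T
  · rw [weight, Set.indicator_of_mem hy, ← volume_closedBall_radius hm (hpos _ hy.1).le]
    congr 1
    ext x
    rw [Set.mem_preimage, mem_Einf_iff, mem_closedBall_zero_iff,
      norm_le_radius_iff hm (hpos _ hy.1).le, and_iff_left hy]
  · rw [weight, Set.indicator_of_notMem hy, mul_zero, ← measure_empty (μ := (volume : Measure (Fin m → ℂ)))]
    congr 1
    ext x
    rw [Set.mem_preimage, mem_Einf_iff]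
    simp only [Set.mem_empty_iff_false, iff_false, not_and]
    exact fun _ => hy

theorem volume_Einf_le (hm : 1 ≤ m) (hn : 1 ≤ n) (hψ : AntitoneOn ψ (Set.Ici 1))
    (hpos : ∀ t, 1 ≤ t → 0 < ψ t) (T : ℝ) :
    volume (Einf m n ψ T) ≤ ENNReal.ofReal Real.pi ^ (m + n) *
      ((∫⁻ t in Set.Ico 1 T, ENNReal.ofReal (ψ t)) + ENNReal.ofReal (ψ 1)) := by
  rw [volume_Einf hm hψ hpos, pow_add, mul_assoc, mul_add]
  gcongr
  refine lintegral_antitone_le hψ hpos (fun τ hτ => ?_) T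
  obtain ⟨R, hR, hRτ⟩ := exists_pow_eq hn (zero_le_one.trans hτ)
  rw [Measure.map_apply (by fun_prop) measurableSet_Icc]
  calc _ ≤ volume (Metric.closedBall (0 : Fin n → ℂ) R) := measure_mono fun y hy => by
        rw [mem_closedBall_zero_iff]
        exact (pow_le_pow_iff_left₀ (norm_nonneg _) hR (by omega)).1 (hy.2.trans hRτ.ge)
    _ = _ := by
        rw [volume_closedBall_fin' n hR, ofReal_pow_eq hR hRτ, ofReal_eq_volume_Ico_add hτ,
          mul_add, mul_one]

theorem le_volume_Einf (hm : 1 ≤ m) (hn : 1 ≤ n) (hψ : AntitoneOn ψ (Set.Ici 1))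
    (hpos : ∀ t, 1 ≤ t → 0 < ψ t) (T : ℝ) :
    ENNReal.ofReal Real.pi ^ (m + n) * (∫⁻ t in Set.Ico 1 T, ENNReal.ofReal (ψ t)) ≤
      volume (Einf m n ψ T) + ENNReal.ofReal Real.pi ^ (m + n) * ENNReal.ofReal (ψ 1) := by
  rw [volume_Einf hm hψ hpos, pow_add, mul_assoc, mul_assoc, ← mul_add]
  gcongr
  rw [← smul_eq_mul, ← lintegral_smul_measure, ← Measure.restrict_smul]
  refine (lintegral_antitone_le (a := 1) hψ hpos (fun τ hτ => ?_) T).trans_eq (by rw [one_mul])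
  obtain ⟨R, hR, hRτ⟩ := exists_pow_eq hn (zero_le_one.trans hτ)
  have hR0 : 0 < R := hR.lt_of_ne' fun h => by
    rw [h, zero_pow (by omega)] at hRτ
    linarith
  rw [Measure.smul_apply, Measure.map_apply (by fun_prop) measurableSet_Ico, one_mul, smul_eq_mul]
  calc ENNReal.ofReal Real.pi ^ n * volume (Set.Icc 1 τ)
      ≤ ENNReal.ofReal Real.pi ^ n * ENNReal.ofReal τ := by
        rw [Real.volume_Icc]
        gcongr
        linarith
    _ = volume (Metric.ball (0 : Fin n → ℂ) R) := by
        rw [volume_ball_fin n 0 hR0, ofReal_pow_eq hR hRτ]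
    _ ≤ volume ((fun y : Fin n → ℂ => ‖y‖ ^ (2 * n)) ⁻¹' Set.Ico 1 τ ∪ Metric.ball 0 1) := by
        refine measure_mono fun y hy => ?_
        rw [mem_ball_zero_iff] at hy
        rcases lt_or_ge ‖y‖ 1 with h | h
        · exact Or.inr (mem_ball_zero_iff.2 h)
        · exact Or.inl ⟨one_le_pow₀ h, hRτ ▸ pow_lt_pow_left₀ hy (norm_nonneg _) (by omega)⟩
    _ ≤ _ := (measure_union_le _ _).trans_eq (by rw [volume_ball_fin n 0 one_pos]; simp)

end Volume

section Pairs

/-- A lattice `Λ` in `ℂ` that is an ideal of an integral subring `O` of `ℂ`, with fundamental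
domain `D` and covering radius at most `Δ`. -/
structure IsIdealLattice (O : Subring ℂ) (Λ : AddSubgroup ℂ) (D : Set ℂ) (Δ : ℝ) : Prop where
  countable : Countable O
  exists_nat : ∀ x ∈ O, ∃ k : ℕ, ‖x‖ ^ 2 = k
  mem : ∀ l ∈ Λ, l ∈ O
  mul_mem : ∀ x ∈ O, ∀ l ∈ Λ, x * l ∈ Λ
  isTile : IsTile Λ D
  coveredBy : CoveredBy Λ Δ
  pos : 0 < Δ
  volume_ne_zero : volume D ≠ 0
  volume_ne_top : volume D ≠ ⊤

variable {O : Subring ℂ} {Λ : AddSubgroup ℂ} {D : Set ℂ} {Δ : ℝ}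

/-- `b` is a denominator of `c` with respect to `O` of minimal absolute value. -/
structure IsDenom (O : Subring ℂ) (c b : ℂ) : Prop where
  mem : b ∈ O
  ne_zero : b ≠ 0
  mul_mem : c * b ∈ O
  le : ∀ x ∈ O, x ≠ 0 → c * x ∈ O → ‖b‖ ≤ ‖x‖

theorem tsum_indicator_le_one {I E : Type*} {s : Set E} {f : I → E}
    (h : ∀ i j, f i ∈ s → f j ∈ s → i = j) : ∑' i, s.indicator (1 : E → ℝ≥0∞) (f i) ≤ 1 := by
  by_cases hi : ∃ i, f i ∈ s
  · obtain ⟨i, hi⟩ := hi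
    rw [tsum_eq_single i fun j hj => Set.indicator_of_notMem (fun hjs => hj (h j i hjs hi)) _]
    exact Set.indicator_le_self' (fun _ _ => zero_le) _
  · push Not at hi
    simp [Set.indicator_of_notMem (hi _)]

namespace IsIdealLattice

theorem one_le_norm (h : IsIdealLattice O Λ D Δ) {x : ℂ} (hx : x ∈ O) (hx0 : x ≠ 0) :
    1 ≤ ‖x‖ := by
  obtain ⟨k, hk⟩ := h.exists_nat x hx
  have : 0 < ‖x‖ ^ 2 := by positivity
  rw [hk] at this
  have hk1 : (1 : ℝ) ≤ k := by exact_mod_cast this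
  rw [← hk] at hk1
  nlinarith [norm_nonneg x]

theorem exists_isDenom (h : IsIdealLattice O Λ D Δ) {c x : ℂ} (hx : x ∈ O) (hx0 : x ≠ 0)
    (hcx : c * x ∈ O) : ∃ b, IsDenom O c b := by
  have hex : ∃ k : ℕ, ∃ b ∈ O, b ≠ 0 ∧ c * b ∈ O ∧ ‖b‖ ^ 2 = k :=
    (h.exists_nat x hx).imp fun k hk => ⟨x, hx, hx0, hcx, hk⟩
  classical
  obtain ⟨b, hb, hb0, hcb, hk⟩ := Nat.find_spec hex
  refine ⟨b, hb, hb0, hcb, fun y hy hy0 hcy => ?_⟩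
  obtain ⟨k, hyk⟩ := h.exists_nat y hy
  have hle : ((Nat.find hex : ℕ) : ℝ) ≤ k :=
    Nat.cast_le.2 (Nat.find_le (h := hex) ⟨y, hy, hy0, hcy, hyk⟩)
  rw [← hk, ← hyk] at hle
  exact (pow_le_pow_iff_left₀ (norm_nonneg _) (norm_nonneg _) two_ne_zero).1 hle

theorem exists_small_mem (h : IsIdealLattice O Λ D Δ) {c b : ℂ} (hb : IsDenom O c b)
    (hΔb : 6 * Δ ≤ ‖b‖) : ∃ x ∈ Λ, ∃ x' ∈ Λ, x + c * x' ≠ 0 ∧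
      ‖x + c * x'‖ ≤ 14 * (volume D).toReal / ‖b‖ := by
  by_contra! hno
  have := h.isTile.countable
  set V := (volume D).toReal with hV
  have hV0 : 0 < V := ENNReal.toReal_pos h.volume_ne_zero h.volume_ne_top
  have hVe : volume D = ENNReal.ofReal V := (ENNReal.ofReal_toReal h.volume_ne_top).symm
  have hb0 : 0 < ‖b‖ := norm_pos_iff.2 hb.ne_zero
  set ρ := 7 * V / ‖b‖ with hρ
  have hρ0 : 0 < ρ := by positivity
  have key (z : ℂ) : ∑' x : Λ, (Metric.closedBall 0 (‖b‖ / 3)).indicator (1 : ℂ → ℝ≥0∞) (0 + x) *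
      cnt Λ ρ (c * x + z) ≤ 1 := by
    simp only [cnt, ← ENNReal.tsum_mul_left]
    rw [← ENNReal.tsum_prod]
    have e (p : Λ × Λ) : (Metric.closedBall 0 (‖b‖ / 3)).indicator (1 : ℂ → ℝ≥0∞) (0 + p.1) *
        (Metric.closedBall 0 ρ).indicator 1 (c * p.1 + z + p.2) =
        (Metric.closedBall (0 : ℂ) (‖b‖ / 3) ×ˢ Metric.closedBall (0 : ℂ) ρ).indicator 1
          ((0 + (p.1 : ℂ), c * p.1 + z + p.2) : ℂ × ℂ) := by
      rw [Set.indicator_prod_one]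
    simp only [e]
    refine tsum_indicator_le_one fun p p' hp hp' => ?_
    simp only [Set.mem_prod, mem_closedBall_zero_iff, zero_add] at hp hp'
    have hα : ‖((p.2 - p'.2 : Λ) : ℂ) + c * ((p.1 - p'.1 : Λ) : ℂ)‖ ≤ 14 * V / ‖b‖ := by
      calc _ = ‖(c * p.1 + z + p.2) - (c * p'.1 + z + p'.2)‖ := by
            push_cast
            ring_nf
        _ ≤ ρ + ρ := (norm_sub_le _ _).trans (add_le_add hp.2 hp'.2)
        _ = _ := by rw [hρ]; ring
    have h0 : ((p.2 - p'.2 : Λ) : ℂ) + c * ((p.1 - p'.1 : Λ) : ℂ) = 0 := by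
      by_contra h0
      exact (hno _ (SetLike.coe_mem _) _ (SetLike.coe_mem _) h0).not_ge hα
    by_cases h1 : p.1 - p'.1 = 0
    · rw [h1] at h0
      simp only [ZeroMemClass.coe_zero, mul_zero, add_zero, ZeroMemClass.coe_eq_zero] at h0
      exact Prod.ext (sub_eq_zero.1 h1) (sub_eq_zero.1 h0)
    · exfalso
      have h2 := hb.le _ (h.mem _ (p.1 - p'.1).2) (fun h0 => h1 (Subtype.ext h0)) (by
        rw [← neg_eq_of_add_eq_zero_right h0]
        exact O.neg_mem (h.mem _ (p.2 - p'.2).2))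
      have h3 : ‖((p.1 - p'.1 : Λ) : ℂ)‖ ≤ ‖b‖ / 3 + ‖b‖ / 3 := by
        push_cast
        exact (norm_sub_le _ _).trans (add_le_add hp.1 hp'.1)
      linarith
  have hmeas (x : Λ) : Measurable fun z => cnt Λ ρ (c * x + z) :=
    (measurable_cnt ρ).comp (measurable_const_add _)
  have h1 : cnt Λ (‖b‖ / 3) 0 * volume (Metric.closedBall (0 : ℂ) ρ) ≤ volume D := by
    calc cnt Λ (‖b‖ / 3) 0 * volume (Metric.closedBall (0 : ℂ) ρ)
        = ∑' x : Λ, ∫⁻ z in D,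
          (Metric.closedBall 0 (‖b‖ / 3)).indicator (1 : ℂ → ℝ≥0∞) (0 + x) *
            cnt Λ ρ (c * x + z) := by
          rw [cnt, ← ENNReal.tsum_mul_right]
          refine tsum_congr fun x => ?_
          rw [lintegral_const_mul _ (hmeas x), h.isTile.setLIntegral_cnt]
      _ = ∫⁻ z in D, ∑' x : Λ,
          (Metric.closedBall 0 (‖b‖ / 3)).indicator (1 : ℂ → ℝ≥0∞) (0 + x) *
            cnt Λ ρ (c * x + z) := by
          rw [lintegral_tsum fun x => ((hmeas x).const_mul _).aemeasurable]
      _ ≤ ∫⁻ _ in D, 1 := lintegral_mono key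
      _ = volume D := by simp
  have h2 := h.isTile.le_volume_mul_cnt h.coveredBy (‖b‖ / 6) 0
  have h3 : cnt Λ (‖b‖ / 6 + Δ) 0 ≤ cnt Λ (‖b‖ / 3) 0 := by
    unfold cnt
    gcongr
    linarith
  have h4 : volume (Metric.closedBall (0 : ℂ) (‖b‖ / 6)) * volume (Metric.closedBall (0 : ℂ) ρ) ≤
      volume D * volume D := by
    calc _ ≤ volume D * cnt Λ (‖b‖ / 3) 0 * volume (Metric.closedBall (0 : ℂ) ρ) := by
          grw [h2, h3]
      _ ≤ _ := by rw [mul_assoc]; gcongr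
  rw [Complex.volume_closedBall, Complex.volume_closedBall, hVe,
    ← ENNReal.ofReal_coe_nnreal (p := NNReal.pi)] at h4
  rw [← ENNReal.ofReal_pow (by positivity), ← ENNReal.ofReal_pow (by positivity),
    ← ENNReal.ofReal_mul (by positivity), ← ENNReal.ofReal_mul (by positivity),
    ← ENNReal.ofReal_mul (by positivity), ← ENNReal.ofReal_mul (by positivity),
    ENNReal.ofReal_le_ofReal_iff (by positivity), NNReal.coe_real_pi] at h4
  have h5 : (‖b‖ / 6) ^ 2 * Real.pi * (ρ ^ 2 * Real.pi) = 49 / 36 * Real.pi ^ 2 * V ^ 2 := by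
    rw [hρ]
    field_simp
    ring
  rw [h5] at h4
  have h6 : (9 : ℝ) < Real.pi ^ 2 := by nlinarith [Real.pi_gt_three]
  have h7 := mul_lt_mul_of_pos_right h6 (sq_pos_of_pos hV0)
  nlinarith [sq_pos_of_pos hV0]

/-- The lattice `Λ + c Λ` has covering radius `O(1 / ‖b‖)` if `b` is a minimal denominator. -/
theorem exists_cover (h : IsIdealLattice O Λ D Δ) {c b : ℂ} (hb : IsDenom O c b) (y : ℂ) :
    ∃ x ∈ Λ, ∃ x' ∈ Λ, ‖y - (x + c * x')‖ ≤ (6 * Δ ^ 2 + 14 * (volume D).toReal * Δ) / ‖b‖ := by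
  have hb0 : 0 < ‖b‖ := norm_pos_iff.2 hb.ne_zero
  have hΔ := h.pos
  rcases le_total (6 * Δ) ‖b‖ with hΔb | hΔb
  · obtain ⟨x, hx, x', hx', h0, hle⟩ := h.exists_small_mem hb hΔb
    obtain ⟨l, hl, hyl⟩ := h.coveredBy (y / (x + c * x'))
    refine ⟨l * x, h.mul_mem l (h.mem l hl) x hx, l * x', h.mul_mem l (h.mem l hl) x' hx', ?_⟩
    calc ‖y - (l * x + c * (l * x'))‖ = ‖(x + c * x') * (y / (x + c * x') - l)‖ := by
          rw [mul_sub, mul_div_cancel₀ _ h0]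
          ring_nf
      _ ≤ (14 * (volume D).toReal / ‖b‖) * Δ := by
          rw [norm_mul]
          gcongr
      _ ≤ _ := by
          rw [div_mul_eq_mul_div]
          gcongr
          nlinarith
  · obtain ⟨l, hl, hyl⟩ := h.coveredBy y
    refine ⟨l, hl, 0, Λ.zero_mem, ?_⟩
    rw [mul_zero, add_zero, le_div_iff₀ hb0]
    have : 0 ≤ (volume D).toReal := ENNReal.toReal_nonneg
    calc ‖y - l‖ * ‖b‖ ≤ Δ * (6 * Δ) := by gcongr
      _ ≤ _ := by nlinarith [mul_nonneg this hΔ.le]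

end IsIdealLattice

end Pairs

section PairBound

variable {O : Subring ℂ} {Λ : AddSubgroup ℂ} {D : Set ℂ} {Δ : ℝ} {m n : ℕ}

/-- The set of pairs `(b, a)` in `O` such that `b` is a minimal denominator of `a / b`,
`|a| ≤ |b|` and `b q = a q'`. -/
def ratioSet (O : Subring ℂ) (q q' : Fin n → ℂ) : Set (O × O) :=
  {p | IsDenom O (p.2 / p.1) p.1 ∧ ‖(p.2 : ℂ)‖ ≤ ‖(p.1 : ℂ)‖ ∧ (p.1 : ℂ) • q = (p.2 : ℂ) • q'}

/-- A bound for the correlation of the conditions given by `q` and `q'`. -/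
def corr (O : Subring ℂ) (m : ℕ) (C : ℝ) (q q' : Fin n → ℂ) : ℝ≥0∞ :=
  ∑' p : O × O, (ratioSet O q q').indicator (fun p => ENNReal.ofReal (C / ‖(p.1 : ℂ)‖) ^ (2 * m)) p

theorem exists_app_eq_of_forall_ne_smul {q q' : Fin n → ℂ} (hq'0 : q' ≠ 0)
    (hne : ∀ c : ℂ, q ≠ c • q') (y : Fin m → ℂ) :
    ∃ η : Fin m → Fin n → ℂ, app η q' = 0 ∧ app η q = y := by
  obtain ⟨i, hi⟩ : ∃ i, q' i ≠ 0 := Function.ne_iff.1 hq'0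
  obtain ⟨j, hj⟩ : ∃ j, q j ≠ ((q i / q' i) • q') j := Function.ne_iff.1 (hne _)
  have hc : q' i * q j - q' j * q i ≠ 0 := fun h0 => hj <| by
    rw [Pi.smul_apply, smul_eq_mul, div_mul_eq_mul_div, eq_div_iff hi]
    linear_combination h0
  refine ⟨col j (fun k => q' i * (y k / (q' i * q j - q' j * q i))) +
    col i (fun k => -q' j * (y k / (q' i * q j - q' j * q i))), ?_, ?_⟩ <;> ext k <;>
    simp only [app_add, app_col, Pi.add_apply, Pi.zero_apply]
  · ring
  · field_simp
    ring

namespace IsIdealLattice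

/-- The constant in the covering radius of `Λ + c Λ`. -/
def coverConst (D : Set ℂ) (Δ : ℝ) : ℝ := 6 * Δ ^ 2 + 14 * (volume D).toReal * Δ

theorem coverConst_nonneg (h : IsIdealLattice O Λ D Δ) : 0 ≤ coverConst D Δ := by
  have := h.pos
  unfold coverConst
  positivity

theorem smul_mem (h : IsIdealLattice O Λ D Δ) {q : Fin n → ℂ} (hq : ∀ j, q j ∈ O) :
    ∀ j, ∀ l ∈ Λ, l * q j ∈ Λ := fun j l hl => mul_comm (q j) l ▸ h.mul_mem _ (hq j) l hl

theorem exists_mem_ratioSet (h : IsIdealLattice O Λ D Δ) {q q' : Fin n → ℂ} (hq : ∀ j, q j ∈ O)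
    (hq' : ∀ j, q' j ∈ O) (hq'0 : q' ≠ 0) (hle : ‖q‖ ≤ ‖q'‖) {c : ℂ} (hc : q = c • q') :
    ∃ p ∈ ratioSet O q q', (p.2 : ℂ) / p.1 = c := by
  obtain ⟨i, hi⟩ : ∃ i, q' i ≠ 0 := Function.ne_iff.1 hq'0
  have hci (j) : c * q' j = q j := by rw [hc]; rfl
  obtain ⟨b, hb⟩ := h.exists_isDenom (hq' i) hi (c := c) (by rw [hci]; exact hq i)
  have hcb : c * b / b = c := mul_div_cancel_right₀ c hb.ne_zero
  refine ⟨(⟨b, hb.mem⟩, ⟨c * b, hb.mul_mem⟩), ⟨?_, ?_, ?_⟩, hcb⟩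
  · simpa only [hcb] using hb
  · rw [hc, norm_smul] at hle
    have : ‖c‖ ≤ 1 := le_of_mul_le_mul_right (by simpa using hle) (norm_pos_iff.2 hq'0)
    rw [norm_mul]
    exact mul_le_of_le_one_left (norm_nonneg _) this
  · rw [hc, smul_smul, mul_comm]

theorem volume_univ_pi (D : Set ℂ) (k : ℕ) :
    volume (Set.univ.pi fun _ : Fin k => D) = volume D ^ k := by
  rw [volume_pi_pi]
  simp

theorem lintegral_hits_mul_hits_le_corr (h : IsIdealLattice O Λ D Δ) (a : Fin m → ℂ)
    {q q' : Fin n → ℂ} (hq : ∀ j, q j ∈ O) (hq' : ∀ j, q' j ∈ O) (hq'0 : q' ≠ 0)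
    (hle : ‖q‖ ≤ ‖q'‖) {r : ℝ} (hr : 0 ≤ r) (r' : ℝ) {K : ℕ} (hK : 1 ≤ K) :
    volume D ^ m * ∫⁻ θ in Set.univ.pi fun _ : Fin m => Set.univ.pi fun _ : Fin n => D,
          hits Λ a q r θ * hits Λ a q' r' θ ≤
      (ENNReal.ofReal Real.pi ^ m * ((1 + 2 ^ (2 * m) / K) * ENNReal.ofReal r ^ (2 * m) +
        (2 * K) ^ (2 * m) * corr O m (coverConst D Δ) q q')) *
      ∫⁻ θ in Set.univ.pi fun _ : Fin m => Set.univ.pi fun _ : Fin n => D, hits Λ a q' r' θ := by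
  by_cases hdep : ∃ c : ℂ, q = c • q'
  · obtain ⟨c, hc⟩ := hdep
    obtain ⟨p, hp, rfl⟩ := h.exists_mem_ratioSet hq hq' hq'0 hle hc
    set c : ℂ := (p.2 : ℂ) / p.1
    have hδ : 0 ≤ coverConst D Δ / ‖(p.1 : ℂ)‖ := div_nonneg h.coverConst_nonneg (norm_nonneg _)
    have key := h.isTile.lintegral_hits_mul_hits_le a (h.smul_mem hq) (h.smul_mem hq') r r'
      (δ := coverConst D Δ / ‖(p.1 : ℂ)‖) fun y => by
        obtain ⟨i, hi⟩ : ∃ i, q' i ≠ 0 := Function.ne_iff.1 hq'0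
        choose x hx x' hx' hle' using h.exists_cover hp.1
        refine ⟨col i fun k => x' (y k) / q' i, ?_, -fun k => x (y k), ?_, ?_⟩
        · rw [app_col]
          intro k
          change x' (y k) / q' i * q' i ∈ Λ
          rw [div_mul_cancel₀ _ hi]
          exact hx' _
        · exact neg_mem fun k => hx (y k)
        · rw [app_col, pi_norm_le_iff_of_nonneg hδ]
          intro k
          have hqi : q i = c * q' i := by rw [hc]; rfl
          have e : y k + -x (y k) - x' (y k) / q' i * q i = y k - (x (y k) + c * x' (y k)) := by
            rw [hqi]
            field_simp
            ring
          exact (congrArg norm e).trans_le (hle' (y k))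
    rw [volume_univ_pi] at key
    refine key.trans ?_
    gcongr
    rw [volume_closedBall_fin' m (add_nonneg hr hδ)]
    gcongr
    refine (ofReal_add_pow_le _ hr hδ hK).trans ?_
    gcongr
    calc ENNReal.ofReal (coverConst D Δ / ‖(p.1 : ℂ)‖) ^ (2 * m)
        = (ratioSet O q q').indicator
          (fun p => ENNReal.ofReal (coverConst D Δ / ‖(p.1 : ℂ)‖) ^ (2 * m)) p :=
          (Set.indicator_of_mem hp fun p : O × O =>
            ENNReal.ofReal (coverConst D Δ / ‖(p.1 : ℂ)‖) ^ (2 * m)).symm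
      _ ≤ _ := ENNReal.le_tsum p
  · push Not at hdep
    have key := h.isTile.lintegral_hits_mul_hits_le a (h.smul_mem hq) (h.smul_mem hq') r r'
      (δ := 0) fun y => by
        obtain ⟨η, h0, hη⟩ := exists_app_eq_of_forall_ne_smul hq'0 hdep y
        exact ⟨η, h0 ▸ zero_mem _, 0, zero_mem _, by simp [hη]⟩
    rw [volume_univ_pi, add_zero] at key
    refine key.trans ?_
    gcongr
    rw [volume_closedBall_fin' m hr]
    gcongr
    rw [add_mul, one_mul, add_assoc]
    exact le_self_add

/-- The second moment of a pair of conditions, whatever the order of the norms. -/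
theorem lintegral_hits_mul_hits_le (h : IsIdealLattice O Λ D Δ) (a : Fin m → ℂ)
    {q q' : Fin n → ℂ} (hq : ∀ j, q j ∈ O) (hq' : ∀ j, q' j ∈ O) (hq0 : q ≠ 0) (hq'0 : q' ≠ 0)
    {r r' : ℝ} (hr : 0 ≤ r) (hr' : 0 ≤ r') {K : ℕ} (hK : 1 ≤ K) :
    volume D ^ (2 * m) * ∫⁻ θ in Set.univ.pi fun _ : Fin m => Set.univ.pi fun _ : Fin n => D,
          hits Λ a q r θ * hits Λ a q' r' θ ≤
      ENNReal.ofReal Real.pi ^ (2 * m) *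
        volume (Set.univ.pi fun _ : Fin m => Set.univ.pi fun _ : Fin n => D) *
        ((1 + 2 ^ (2 * m) / K) * (ENNReal.ofReal r ^ (2 * m) * ENNReal.ofReal r' ^ (2 * m)) +
        (2 * K) ^ (2 * m) * (ENNReal.ofReal r' ^ (2 * m) * corr O m (coverConst D Δ) q q' +
          ENNReal.ofReal r ^ (2 * m) * corr O m (coverConst D Δ) q' q)) := by
  wlog hle : ‖q‖ ≤ ‖q'‖ generalizing q q' r r'
  · have := this hq' hq hq'0 hq0 hr' hr (le_of_not_ge hle)
    simp only [mul_comm (hits Λ a q' r' _)] at this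
    refine this.trans_eq ?_
    ring
  have h1 := h.lintegral_hits_mul_hits_le_corr a hq hq' hq'0 hle hr r' hK
  have h2 := h.isTile.lintegral_hits a (h.smul_mem hq') hq'0 r'
  rw [volume_univ_pi, volume_closedBall_fin' m hr'] at h2
  calc _ = volume D ^ m * (volume D ^ m *
        ∫⁻ θ in Set.univ.pi fun _ : Fin m => Set.univ.pi fun _ : Fin n => D,
          hits Λ a q r θ * hits Λ a q' r' θ) := by
        rw [← mul_assoc, ← pow_add, two_mul]
    _ ≤ (ENNReal.ofReal Real.pi ^ m * ((1 + 2 ^ (2 * m) / K) * ENNReal.ofReal r ^ (2 * m) +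
        (2 * K) ^ (2 * m) * corr O m (coverConst D Δ) q q')) * (volume D ^ m *
        ∫⁻ θ in Set.univ.pi fun _ : Fin m => Set.univ.pi fun _ : Fin n => D,
          hits Λ a q' r' θ) := by
        grw [h1]
        apply le_of_eq
        ring
    _ = ENNReal.ofReal Real.pi ^ (2 * m) *
        volume (Set.univ.pi fun _ : Fin m => Set.univ.pi fun _ : Fin n => D) *
        ((1 + 2 ^ (2 * m) / K) * (ENNReal.ofReal r ^ (2 * m) * ENNReal.ofReal r' ^ (2 * m)) +
        (2 * K) ^ (2 * m) * (ENNReal.ofReal r' ^ (2 * m) * corr O m (coverConst D Δ) q q')) := by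
        rw [h2]
        ring
    _ ≤ _ := by
        gcongr
        exact le_self_add

end IsIdealLattice

end PairBound

section CorrSum

variable {O : Subring ℂ} {Λ : AddSubgroup ℂ} {D : Set ℂ} {Δ : ℝ} {m n : ℕ} {ψ : ℝ → ℝ}
  {I : Type*} [Countable I]

namespace IsIdealLattice

theorem tsum_norm_le_le (h : IsIdealLattice O Λ D Δ) {R : ℝ} (hR : 1 ≤ R) :
    ∑' a : O, (Metric.closedBall 0 R).indicator (1 : ℂ → ℝ≥0∞) a ≤ 10 * ENNReal.ofReal R ^ 2 := by
  have := h.countable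
  have h1 := tsum_indicator_ball_le (fun a : {a : O // a ≠ 0} => ((a : O) : ℂ))
    (fun i j hij => h.one_le_norm (O.sub_mem (i : O).2 (j : O).2)
      (sub_ne_zero.2 fun e => hij (Subtype.ext (Subtype.ext e))))
    (fun i => h.one_le_norm (i : O).2 (fun e => i.2 (Subtype.ext e))) (R := R) (by linarith)
  have h2 : (1 : ℝ≥0∞) ≤ ENNReal.ofReal R ^ 2 :=
    one_le_pow₀ (ENNReal.one_le_ofReal.2 hR)
  classical
  have h3 : ∑' a : O, (if a = 0 then 0 else
      (Metric.closedBall 0 R).indicator (1 : ℂ → ℝ≥0∞) a) ≤ 9 * ENNReal.ofReal R ^ 2 := by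
    refine le_trans (le_of_eq ?_) h1
    refine Eq.trans ?_ (tsum_subtype {a : O | a ≠ 0}
      fun a : O => (Metric.closedBall 0 R).indicator (1 : ℂ → ℝ≥0∞) a).symm
    refine tsum_congr fun a => ?_
    by_cases ha : a = 0 <;> simp [ha]
  calc _ ≤ 1 + 9 * ENNReal.ofReal R ^ 2 := by
        rw [ENNReal.tsum_eq_add_tsum_ite (0 : O)]
        exact add_le_add (Set.indicator_le_self' (fun _ _ => zero_le) _) (le_of_eq_of_le (tsum_congr fun a => by congr) h3)
    _ ≤ ENNReal.ofReal R ^ 2 + 9 * ENNReal.ofReal R ^ 2 := by gcongr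
    _ = _ := by ring

theorem tsum_ratio_le (h : IsIdealLattice O Λ D Δ) :
    ∑' p : O × O, {p : O × O | (p.1 : ℂ) ≠ 0 ∧ ‖(p.2 : ℂ)‖ ≤ ‖(p.1 : ℂ)‖}.indicator
      (fun p => ENNReal.ofReal ‖(p.1 : ℂ)‖⁻¹ ^ 6) p ≤ 180 := by
  have := h.countable
  rw [ENNReal.tsum_prod']
  calc _ ≤ ∑' b : O, {b : O | b ≠ 0}.indicator
        (fun b => 10 * ENNReal.ofReal (‖(b : ℂ)‖⁻¹ ^ 4)) b := by
        gcongr with b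
        by_cases hb : b = 0
        · simp [hb]
        · have hb' : (b : ℂ) ≠ 0 := fun e => hb (Subtype.ext e)
          have hb1 := h.one_le_norm b.2 hb'
          rw [Set.indicator_of_mem (show b ∈ {b : O | b ≠ 0} from hb)]
          calc _ = ∑' a : O, ENNReal.ofReal ‖(b : ℂ)‖⁻¹ ^ 6 *
                (Metric.closedBall 0 ‖(b : ℂ)‖).indicator (1 : ℂ → ℝ≥0∞) a := by
                refine tsum_congr fun a => ?_
                by_cases ha : ‖(a : ℂ)‖ ≤ ‖(b : ℂ)‖
                · rw [Set.indicator_of_mem (show (b, a) ∈ {p : O × O | (p.1 : ℂ) ≠ 0 ∧ ‖(p.2 : ℂ)‖ ≤ ‖(p.1 : ℂ)‖} from ⟨hb', ha⟩),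
                    Set.indicator_of_mem (by simpa using ha)]
                  simp
                · rw [Set.indicator_of_notMem (show (b, a) ∉ {p : O × O | (p.1 : ℂ) ≠ 0 ∧ ‖(p.2 : ℂ)‖ ≤ ‖(p.1 : ℂ)‖} from fun h => ha h.2),
                    Set.indicator_of_notMem (by simpa using ha), mul_zero]
            _ ≤ ENNReal.ofReal ‖(b : ℂ)‖⁻¹ ^ 6 * (10 * ENNReal.ofReal ‖(b : ℂ)‖ ^ 2) := by
                rw [ENNReal.tsum_mul_left]
                gcongr
                exact h.tsum_norm_le_le hb1
            _ = _ := by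
                rw [← ENNReal.ofReal_pow (by positivity), ← ENNReal.ofReal_pow (by positivity),
                  mul_left_comm, ← ENNReal.ofReal_mul (by positivity)]
                congr 2
                field_simp
    _ = 10 * ∑' b : {b : O | b ≠ 0}, ENNReal.ofReal (‖((b : O) : ℂ)‖⁻¹ ^ 4) := by
        rw [← tsum_subtype, ENNReal.tsum_mul_left]
    _ ≤ 10 * 18 := by
        gcongr
        exact tsum_inv_norm_pow_le (fun a : {b : O | b ≠ 0} => ((a : O) : ℂ))
          (fun i j hij => h.one_le_norm (O.sub_mem (i : O).2 (j : O).2)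
            (sub_ne_zero.2 fun e => hij (Subtype.ext (Subtype.ext e))))
          (fun i => h.one_le_norm (i : O).2 (fun e => i.2 (Subtype.ext e)))
    _ = 180 := by norm_num

theorem tsum_weight_denom_le (hn : 1 ≤ n) {q : I → Fin n → ℂ}
    (hq : ∀ i j, q i j ∈ O) (hinj : Function.Injective q) (hψ : AntitoneOn ψ (Set.Ici 1))
    (hpos : ∀ t, 1 ≤ t → 0 < ψ t) (T : ℝ) {c b : ℂ} (hb : IsDenom O c b) :
    ∑' i, {i | ∀ j, c * q i j ∈ O}.indicator (fun i => weight ψ T (‖q i‖ ^ (2 * n))) i ≤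
      ENNReal.ofReal ‖b‖⁻¹ ^ (2 * n) * (9 ^ n * ((∫⁻ t in Set.Ico 1 T, ENNReal.ofReal (ψ t)) +
        ENNReal.ofReal (ψ 1))) := by
  have hb0 : 0 < ‖b‖ := norm_pos_iff.2 hb.ne_zero
  set s : Set I := {i | (∀ j, c * q i j ∈ O) ∧ q i ≠ 0}
  have e : ∑' i, {i | ∀ j, c * q i j ∈ O}.indicator (fun i => weight ψ T (‖q i‖ ^ (2 * n))) i =
      ∑' i : s, weight ψ T (‖q i‖ ^ (2 * n)) := by
    rw [tsum_subtype s fun i => weight ψ T (‖q i‖ ^ (2 * n))]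
    refine tsum_congr fun i => ?_
    by_cases hi0 : q i = 0
    · have : weight ψ T (‖q i‖ ^ (2 * n)) = 0 := by
        rw [hi0, norm_zero, zero_pow (by omega)]
        exact Set.indicator_of_notMem (by simp) _
      simp [Set.indicator_apply_eq_zero.2, this]
    · by_cases hi : ∀ j, c * q i j ∈ O
      · rw [Set.indicator_of_mem (show i ∈ {i | ∀ j, c * q i j ∈ O} from hi),
          Set.indicator_of_mem (show i ∈ s from ⟨hi, hi0⟩)]
      · rw [Set.indicator_of_notMem (show i ∉ {i | ∀ j, c * q i j ∈ O} from hi),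
          Set.indicator_of_notMem (show i ∉ s from fun h => hi h.1)]
  have key := tsum_weight_mul_le hn (fun i : s => q i) hb0 (fun i j hij => ?_) (fun i => ?_)
    hψ hpos T
  · rw [e, mul_add, ← ENNReal.mul_le_mul_iff_right (a := ENNReal.ofReal ‖b‖ ^ (2 * n)) (by simp [hb.ne_zero])
      (by finiteness), ← mul_assoc, ← mul_pow, ← ENNReal.ofReal_mul hb0.le, mul_inv_cancel₀ hb0.ne',
      ENNReal.ofReal_one, one_pow, one_mul]
    exact key
  · obtain ⟨k, hk⟩ := Function.ne_iff.1 (sub_ne_zero.2 (hinj.ne (Subtype.coe_ne_coe.2 hij)))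
    refine (hb.le _ (O.sub_mem (hq _ k) (hq _ k)) hk ?_).trans (norm_le_pi_norm (q i - q j) k)
    rw [mul_sub]
    exact O.sub_mem (i.2.1 k) (j.2.1 k)
  · obtain ⟨k, hk⟩ := Function.ne_iff.1 i.2.2
    exact (hb.le _ (hq _ k) hk (i.2.1 k)).trans (norm_le_pi_norm (q i) k)

theorem tsum_weight_mul_corr_le (h : IsIdealLattice O Λ D Δ) (hn : 1 ≤ n) (hd : 3 ≤ m + n)
    {q : I → Fin n → ℂ} (hq : ∀ i j, q i j ∈ O) (hinj : Function.Injective q)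
    (hψ : AntitoneOn ψ (Set.Ici 1)) (hpos : ∀ t, 1 ≤ t → 0 < ψ t) (T : ℝ) :
    ∑' i', ∑' i, weight ψ T (‖q i'‖ ^ (2 * n)) * corr O m (coverConst D Δ) (q i) (q i') ≤
      180 * ENNReal.ofReal (coverConst D Δ) ^ (2 * m) * 9 ^ n *
        ((∫⁻ t in Set.Ico 1 T, ENNReal.ofReal (ψ t)) + ENNReal.ofReal (ψ 1)) := by
  set C := coverConst D Δ
  set B := (∫⁻ t in Set.Ico 1 T, ENNReal.ofReal (ψ t)) + ENNReal.ofReal (ψ 1)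
  set A : Set (O × O) := {p | IsDenom O (p.2 / p.1) p.1 ∧ ‖(p.2 : ℂ)‖ ≤ ‖(p.1 : ℂ)‖}
  have hinner (p : O × O) (i' : I) : ∑' i, (ratioSet O (q i) (q i')).indicator
        (fun p => ENNReal.ofReal (C / ‖(p.1 : ℂ)‖) ^ (2 * m)) p ≤
      A.indicator (fun p => ENNReal.ofReal (C / ‖(p.1 : ℂ)‖) ^ (2 * m) *
        {i | ∀ j, (p.2 / p.1 : ℂ) * q i j ∈ O}.indicator 1 i') p := by
    by_cases hex : ∃ i, p ∈ ratioSet O (q i) (q i')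
    · obtain ⟨i, hi⟩ := hex
      have hb0 := hi.1.ne_zero
      rw [tsum_eq_single i fun k hk => Set.indicator_of_notMem (fun hpk => hk (hinj ?_)) _,
        Set.indicator_of_mem hi, Set.indicator_of_mem (show p ∈ A from ⟨hi.1, hi.2.1⟩),
        Set.indicator_of_mem]
      · simp
      · intro j
        have e : (p.1 : ℂ) * q i j = p.2 * q i' j := congrFun hi.2.2 j
        have : (p.2 / p.1 : ℂ) * q i' j = q i j := by
          field_simp
          exact e.symm
        rw [this]
        exact hq i j
      · exact smul_right_injective _ hb0 (hpk.2.2.trans hi.2.2.symm)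
    · push Not at hex
      simp [Set.indicator_of_notMem (hex _)]
  calc _ = ∑' i', ∑' p : O × O, weight ψ T (‖q i'‖ ^ (2 * n)) *
        ∑' i, (ratioSet O (q i) (q i')).indicator
          (fun p => ENNReal.ofReal (C / ‖(p.1 : ℂ)‖) ^ (2 * m)) p := by
        refine tsum_congr fun i' => ?_
        simp only [corr, ENNReal.tsum_mul_left]
        rw [ENNReal.tsum_comm]
    _ ≤ ∑' i', ∑' p : O × O, weight ψ T (‖q i'‖ ^ (2 * n)) *
        A.indicator (fun p => ENNReal.ofReal (C / ‖(p.1 : ℂ)‖) ^ (2 * m) *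
        {i | ∀ j, (p.2 / p.1 : ℂ) * q i j ∈ O}.indicator 1 i') p := by
        gcongr with i' p
        exact hinner p i'
    _ = ∑' p : O × O, A.indicator (fun p => ENNReal.ofReal (C / ‖(p.1 : ℂ)‖) ^ (2 * m) *
          ∑' i', {i | ∀ j, (p.2 / p.1 : ℂ) * q i j ∈ O}.indicator
            (fun i => weight ψ T (‖q i‖ ^ (2 * n))) i') p := by
        rw [ENNReal.tsum_comm]
        refine tsum_congr fun p => ?_
        by_cases hp : p ∈ A
        · simp only [Set.indicator_of_mem hp]
          rw [← ENNReal.tsum_mul_left]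
          refine tsum_congr fun i' => ?_
          rw [mul_left_comm]
          congr 1
          classical
          simp [Set.indicator_apply]
        · simp [Set.indicator_of_notMem hp]
    _ ≤ ∑' p : O × O, (ENNReal.ofReal C ^ (2 * m) * (9 ^ n * B)) *
        {p : O × O | (p.1 : ℂ) ≠ 0 ∧ ‖(p.2 : ℂ)‖ ≤ ‖(p.1 : ℂ)‖}.indicator
          (fun p => ENNReal.ofReal ‖(p.1 : ℂ)‖⁻¹ ^ 6) p := by
        gcongr with p
        by_cases hp : p ∈ A
        · rw [Set.indicator_of_mem hp, Set.indicator_of_mem (show p ∈ {p : O × O | (p.1 : ℂ) ≠ 0 ∧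
            ‖(p.2 : ℂ)‖ ≤ ‖(p.1 : ℂ)‖} from ⟨hp.1.ne_zero, hp.2⟩)]
          have h1 : 1 ≤ ‖(p.1 : ℂ)‖ := h.one_le_norm hp.1.mem hp.1.ne_zero
          have h2 : ENNReal.ofReal ‖(p.1 : ℂ)‖⁻¹ ≤ 1 :=
            ENNReal.ofReal_le_one.2 (inv_le_one_of_one_le₀ h1)
          calc _ ≤ ENNReal.ofReal (C / ‖(p.1 : ℂ)‖) ^ (2 * m) *
                (ENNReal.ofReal ‖(p.1 : ℂ)‖⁻¹ ^ (2 * n) * (9 ^ n * B)) := by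
                gcongr
                exact tsum_weight_denom_le hn hq hinj hψ hpos T hp.1
            _ = ENNReal.ofReal C ^ (2 * m) * (9 ^ n * B) *
                ENNReal.ofReal ‖(p.1 : ℂ)‖⁻¹ ^ (2 * (m + n)) := by
                rw [div_eq_mul_inv, ENNReal.ofReal_mul h.coverConst_nonneg]
                ring
            _ ≤ _ := by
                gcongr 1
                exact pow_le_pow_of_le_one zero_le h2 (by omega)
        · rw [Set.indicator_of_notMem hp]
          exact zero_le
    _ ≤ (ENNReal.ofReal C ^ (2 * m) * (9 ^ n * B)) * 180 := by
        rw [ENNReal.tsum_mul_left]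
        gcongr
        exact h.tsum_ratio_le
    _ = _ := by ring

end IsIdealLattice

end CorrSum

section SecondMoment

variable {O : Subring ℂ} {Λ : AddSubgroup ℂ} {D : Set ℂ} {Δ : ℝ} {m n : ℕ} {ψ : ℝ → ℝ}

/-- The number of solutions with denominator `q`, if the height of `q` lies in `[1, T)`. -/
def hitsBelow (Λ : AddSubgroup ℂ) (ψ : ℝ → ℝ) (T : ℝ) (a : Fin m → ℂ) (q : Fin n → ℂ)
    (θ : Fin m → Fin n → ℂ) : ℝ≥0∞ :=
  (Set.Ico 1 T).indicator (fun t => hits Λ a q (radius m ψ t) θ) (‖q‖ ^ (2 * n))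

/-- The number of solutions with numerator in `-a + Λ ^ m` and denominator in `w + Λ ^ n`. -/
def solutions (Λ : AddSubgroup ℂ) (ψ : ℝ → ℝ) (a : Fin m → ℂ) (w : Fin n → ℂ) (T : ℝ)
    (θ : Fin m → Fin n → ℂ) : ℝ≥0∞ :=
  ∑' l : piSubgroup (Fin n) Λ, hitsBelow Λ ψ T a (w + (l : Fin n → ℂ)) θ

/-- The weighted number of denominators in `w + Λ ^ n`. -/
def denomWeight (Λ : AddSubgroup ℂ) (ψ : ℝ → ℝ) (w : Fin n → ℂ) (T : ℝ) : ℝ≥0∞ :=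
  ∑' l : piSubgroup (Fin n) Λ, weight ψ T (‖w + l‖ ^ (2 * n))

theorem tsum_tsum_mul_add {I : Type*} (A B E : ℝ≥0∞) (x : I → ℝ≥0∞) (f g : I → I → ℝ≥0∞) :
    ∑' i, ∑' j, A * (B * (x i * x j) + E * (f i j + g i j)) =
      A * (B * (∑' i, x i) ^ 2 + E * ((∑' i, ∑' j, f i j) + ∑' i, ∑' j, g i j)) := by
  simp only [ENNReal.tsum_mul_left, ENNReal.tsum_add, ENNReal.tsum_mul_right, sq]

namespace IsIdealLattice

theorem measurable_hitsBelow (h : IsIdealLattice O Λ D Δ) (T : ℝ) (a : Fin m → ℂ)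
    (q : Fin n → ℂ) : Measurable (hitsBelow Λ ψ T a q) := by
  by_cases hq : ‖q‖ ^ (2 * n) ∈ Set.Ico 1 T
  · have e : hitsBelow Λ ψ T a q = hits Λ a q (radius m ψ (‖q‖ ^ (2 * n))) :=
      funext fun θ => Set.indicator_of_mem hq _
    exact e ▸ h.isTile.measurable_hits a q _
  · have e : hitsBelow Λ ψ T a q = fun _ => 0 := funext fun θ => Set.indicator_of_notMem hq _
    exact e ▸ measurable_const

theorem measurable_solutions (h : IsIdealLattice O Λ D Δ) (a : Fin m → ℂ)
    (w : Fin n → ℂ) (T : ℝ) : Measurable (solutions Λ ψ a w T) := by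
  have := (h.isTile.pi (ι := Fin n)).countable
  exact Measurable.tsum (L := .unconditional _) fun l => h.measurable_hitsBelow T a _

theorem lintegral_hitsBelow (h : IsIdealLattice O Λ D Δ) (hm : 1 ≤ m) (hn : 1 ≤ n)
    (hpos : ∀ t, 1 ≤ t → 0 < ψ t) (T : ℝ) (a : Fin m → ℂ) {q : Fin n → ℂ} (hq : ∀ j, q j ∈ O) :
    volume D ^ m * ∫⁻ θ in Set.univ.pi fun _ : Fin m => Set.univ.pi fun _ : Fin n => D,
        hitsBelow Λ ψ T a q θ =
      ENNReal.ofReal Real.pi ^ m * weight ψ T (‖q‖ ^ (2 * n)) *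
        volume (Set.univ.pi fun _ : Fin m => Set.univ.pi fun _ : Fin n => D) := by
  by_cases hqT : ‖q‖ ^ (2 * n) ∈ Set.Ico 1 T
  · have hq0 : q ≠ 0 := by
      rintro rfl
      simp [show n ≠ 0 by omega] at hqT
      linarith
    have h0 := (hpos _ hqT.1).le
    simp only [hitsBelow, weight, Set.indicator_of_mem hqT]
    rw [← volume_univ_pi D m, h.isTile.lintegral_hits a (h.smul_mem hq) hq0,
      volume_closedBall_radius hm h0]
  · simp [hitsBelow, weight, Set.indicator_of_notMem hqT]

theorem lintegral_hitsBelow_mul_le (h : IsIdealLattice O Λ D Δ) (hm : 1 ≤ m) (hn : 1 ≤ n)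
    (hpos : ∀ t, 1 ≤ t → 0 < ψ t) (T : ℝ) (a : Fin m → ℂ) {q q' : Fin n → ℂ}
    (hq : ∀ j, q j ∈ O) (hq' : ∀ j, q' j ∈ O) {K : ℕ} (hK : 1 ≤ K) :
    volume D ^ (2 * m) * ∫⁻ θ in Set.univ.pi fun _ : Fin m => Set.univ.pi fun _ : Fin n => D,
        hitsBelow Λ ψ T a q θ * hitsBelow Λ ψ T a q' θ ≤
      ENNReal.ofReal Real.pi ^ (2 * m) *
        volume (Set.univ.pi fun _ : Fin m => Set.univ.pi fun _ : Fin n => D) *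
        ((1 + 2 ^ (2 * m) / K) * (weight ψ T (‖q‖ ^ (2 * n)) * weight ψ T (‖q'‖ ^ (2 * n))) +
        (2 * K) ^ (2 * m) * (weight ψ T (‖q'‖ ^ (2 * n)) * corr O m (coverConst D Δ) q q' +
          weight ψ T (‖q‖ ^ (2 * n)) * corr O m (coverConst D Δ) q' q)) := by
  have hne {q : Fin n → ℂ} (hqT : ‖q‖ ^ (2 * n) ∈ Set.Ico 1 T) : q ≠ 0 := by
    rintro rfl
    simp [show n ≠ 0 by omega] at hqT
    linarith
  have hrad {q : Fin n → ℂ} (hqT : ‖q‖ ^ (2 * n) ∈ Set.Ico 1 T) :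
      ENNReal.ofReal (ψ (‖q‖ ^ (2 * n))) =
        ENNReal.ofReal (radius m ψ (‖q‖ ^ (2 * n))) ^ (2 * m) := by
    have h0 := (hpos _ hqT.1).le
    rw [← ENNReal.ofReal_pow (radius_nonneg h0), radius_pow hm h0]
  by_cases hqT : ‖q‖ ^ (2 * n) ∈ Set.Ico 1 T
  · by_cases hqT' : ‖q'‖ ^ (2 * n) ∈ Set.Ico 1 T
    · simp only [hitsBelow, weight, Set.indicator_of_mem hqT, Set.indicator_of_mem hqT',
        hrad hqT, hrad hqT']
      exact h.lintegral_hits_mul_hits_le a hq hq' (hne hqT) (hne hqT')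
        (radius_nonneg (hpos _ hqT.1).le) (radius_nonneg (hpos _ hqT'.1).le) hK
    · simp [hitsBelow, Set.indicator_of_notMem hqT']
  · simp [hitsBelow, Set.indicator_of_notMem hqT]

theorem add_mem (h : IsIdealLattice O Λ D Δ) {w : Fin n → ℂ} (hw : ∀ j, w j ∈ O)
    (l : piSubgroup (Fin n) Λ) (j : Fin n) : (w + (l : Fin n → ℂ)) j ∈ O :=
  O.add_mem (hw j) (h.mem _ (mem_piSubgroup.1 l.2 j))

theorem lintegral_solutions (h : IsIdealLattice O Λ D Δ) (hm : 1 ≤ m) (hn : 1 ≤ n)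
    (hpos : ∀ t, 1 ≤ t → 0 < ψ t) (a : Fin m → ℂ) {w : Fin n → ℂ} (hw : ∀ j, w j ∈ O) (T : ℝ) :
    volume D ^ m * ∫⁻ θ in Set.univ.pi fun _ : Fin m => Set.univ.pi fun _ : Fin n => D,
        solutions Λ ψ a w T θ =
      ENNReal.ofReal Real.pi ^ m * denomWeight Λ ψ w T *
        volume (Set.univ.pi fun _ : Fin m => Set.univ.pi fun _ : Fin n => D) := by
  have := (h.isTile.pi (ι := Fin n)).countable
  simp only [solutions, denomWeight]
  rw [lintegral_tsum fun l => (h.measurable_hitsBelow T a _).aemeasurable, ← ENNReal.tsum_mul_left,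
    ← ENNReal.tsum_mul_left, ← ENNReal.tsum_mul_right]
  exact tsum_congr fun l => h.lintegral_hitsBelow hm hn hpos T a (h.add_mem hw l)

theorem lintegral_solutions_sq_le (h : IsIdealLattice O Λ D Δ) (hm : 1 ≤ m) (hn : 1 ≤ n)
    (hd : 3 ≤ m + n) (hψ : AntitoneOn ψ (Set.Ici 1))
    (hpos : ∀ t, 1 ≤ t → 0 < ψ t) (a : Fin m → ℂ) {w : Fin n → ℂ} (hw : ∀ j, w j ∈ O) (T : ℝ)
    {K : ℕ} (hK : 1 ≤ K) :
    volume D ^ (2 * m) * ∫⁻ θ in Set.univ.pi fun _ : Fin m => Set.univ.pi fun _ : Fin n => D,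
        solutions Λ ψ a w T θ ^ 2 ≤
      ENNReal.ofReal Real.pi ^ (2 * m) *
        volume (Set.univ.pi fun _ : Fin m => Set.univ.pi fun _ : Fin n => D) *
        ((1 + 2 ^ (2 * m) / K) * denomWeight Λ ψ w T ^ 2 +
        (2 * K) ^ (2 * m) * (360 * ENNReal.ofReal (coverConst D Δ) ^ (2 * m) * 9 ^ n *
        ((∫⁻ t in Set.Ico 1 T, ENNReal.ofReal (ψ t)) + ENNReal.ofReal (ψ 1)))) := by
  have := (h.isTile.pi (ι := Fin n)).countable
  have hinj : Function.Injective fun l : piSubgroup (Fin n) Λ => w + (l : Fin n → ℂ) :=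
    fun l l' e => Subtype.ext (add_left_cancel e)
  have hc := h.tsum_weight_mul_corr_le hn hd (fun l => h.add_mem hw l) hinj hψ hpos T
  have hc' := hc
  rw [ENNReal.tsum_comm] at hc'
  calc _ = ∑' l : piSubgroup (Fin n) Λ, ∑' l' : piSubgroup (Fin n) Λ, volume D ^ (2 * m) *
        ∫⁻ θ in Set.univ.pi fun _ : Fin m => Set.univ.pi fun _ : Fin n => D,
          hitsBelow Λ ψ T a (w + (l : Fin n → ℂ)) θ * hitsBelow Λ ψ T a (w + (l' : Fin n → ℂ)) θ := by
        simp only [ENNReal.tsum_mul_left]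
        congr 1
        have hmul (l l' : piSubgroup (Fin n) Λ) : Measurable fun θ : Fin m → Fin n → ℂ =>
            hitsBelow Λ ψ T a (w + (l : Fin n → ℂ)) θ * hitsBelow Λ ψ T a (w + (l' : Fin n → ℂ)) θ :=
          (h.measurable_hitsBelow T a _).mul (h.measurable_hitsBelow T a _)
        calc _ = ∫⁻ θ in Set.univ.pi fun _ : Fin m => Set.univ.pi fun _ : Fin n => D,
              ∑' l : piSubgroup (Fin n) Λ, ∑' l' : piSubgroup (Fin n) Λ,
              hitsBelow Λ ψ T a (w + (l : Fin n → ℂ)) θ *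
                hitsBelow Λ ψ T a (w + (l' : Fin n → ℂ)) θ := by
              refine lintegral_congr fun θ => ?_
              rw [solutions, sq, ← ENNReal.tsum_mul_right]
              exact tsum_congr fun l => ENNReal.tsum_mul_left.symm
          _ = _ := by
              rw [lintegral_tsum fun l => (Measurable.tsum (L := .unconditional _)
                (hmul l)).aemeasurable]
              exact tsum_congr fun l => lintegral_tsum fun l' => (hmul l l').aemeasurable
    _ ≤ _ := ENNReal.tsum_le_tsum fun l => ENNReal.tsum_le_tsum fun l' =>
          h.lintegral_hitsBelow_mul_le hm hn hpos T a (h.add_mem hw l) (h.add_mem hw l') hK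
    _ = _ := tsum_tsum_mul_add _ _ _ _ _ _
    _ ≤ _ := by
        rw [denomWeight]
        gcongr
        refine (add_le_add hc' hc).trans (le_of_eq ?_)
        ring

end IsIdealLattice

end SecondMoment

section Asymptotics

theorem lintegral_sq_sub_le {Ω : Type*} [MeasurableSpace Ω] {μ : Measure Ω} [IsFiniteMeasure μ]
    {X : Ω → ℝ≥0∞} (hX : Measurable X) {a v : ℝ} (ha : 0 ≤ a) (hv : 0 ≤ v)
    (h1 : ∫⁻ x, X x ∂μ = ENNReal.ofReal a * μ Set.univ)
    (h2 : ∫⁻ x, X x ^ 2 ∂μ ≤ ENNReal.ofReal (a ^ 2 + v) * μ Set.univ) :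
    ∫⁻ x, ENNReal.ofReal (((X x).toReal - a) ^ 2) ∂μ ≤ ENNReal.ofReal v * μ Set.univ := by
  have hfin : ∀ᵐ x ∂μ, X x < ⊤ := ae_lt_top hX (by rw [h1]; finiteness)
  have hpt : ∀ᵐ x ∂μ, ENNReal.ofReal (((X x).toReal - a) ^ 2) + ENNReal.ofReal (2 * a) * X x =
      X x ^ 2 + ENNReal.ofReal (a ^ 2) := by
    filter_upwards [hfin] with x hx
    lift X x to ℝ≥0 using hx.ne with y
    rw [← ENNReal.ofReal_coe_nnreal, ENNReal.toReal_ofReal y.coe_nonneg, ← ENNReal.ofReal_mul (by positivity),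
      ← ENNReal.ofReal_add (by positivity) (by positivity), ← ENNReal.ofReal_pow y.coe_nonneg,
      ← ENNReal.ofReal_add (by positivity) (by positivity)]
    congr 1
    ring
  have h3 := lintegral_congr_ae hpt
  rw [lintegral_add_right _ (hX.const_mul _), lintegral_const_mul _ hX, h1,
    lintegral_add_right _ measurable_const, lintegral_const] at h3
  have h4 : ENNReal.ofReal (2 * a) * (ENNReal.ofReal a * μ Set.univ) ≠ ⊤ := by finiteness
  rw [← ENNReal.add_le_add_iff_right h4, h3]
  calc _ ≤ ENNReal.ofReal (a ^ 2 + v) * μ Set.univ + ENNReal.ofReal (a ^ 2) * μ Set.univ := by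
        gcongr
    _ = _ := by
        rw [← mul_assoc, ← ENNReal.ofReal_mul (by positivity), ← add_mul, ← add_mul,
          ← ENNReal.ofReal_add (by positivity) (by positivity),
          ← ENNReal.ofReal_add (by positivity) (by positivity)]
        congr 2
        ring

theorem ae_tendsto_zero_of_lintegral_sq_le {Ω : Type*} [MeasurableSpace Ω] {μ : Measure Ω}
    [IsFiniteMeasure μ] {Y : ℕ → Ω → ℝ} (hY : ∀ k, Measurable (Y k)) {C : ℝ}
    (h : ∀ k : ℕ, ∫⁻ x, ENNReal.ofReal (Y k x ^ 2) ∂μ ≤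
      ENNReal.ofReal (C * ((k + 1 : ℝ) ^ 2)⁻¹) * μ Set.univ) :
    ∀ᵐ x ∂μ, Tendsto (fun k => Y k x) atTop (𝓝 0) := by
  have hsum : Summable fun k : ℕ => C * ((k + 1 : ℝ) ^ 2)⁻¹ := by
    have := (summable_nat_add_iff 1).2 (Real.summable_nat_pow_inv.2 (by norm_num : 1 < 2))
    simpa using this.mul_left C
  have hm : ∀ k, Measurable fun x => ENNReal.ofReal (Y k x ^ 2) := fun k =>
    ((hY k).pow_const 2).ennreal_ofReal
  have hfin : ∫⁻ x, ∑' k, ENNReal.ofReal (Y k x ^ 2) ∂μ ≠ ⊤ := by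
    rw [lintegral_tsum fun k => (hm k).aemeasurable]
    refine ne_top_of_le_ne_top ?_ (ENNReal.tsum_le_tsum h)
    rw [ENNReal.tsum_mul_right]
    exact ENNReal.mul_ne_top hsum.tsum_ofReal_ne_top (measure_ne_top _ _)
  filter_upwards [ae_lt_top (Measurable.tsum (L := .unconditional _) hm) hfin] with x hx
  have h0 := ENNReal.tendsto_atTop_zero_of_tsum_ne_top hx.ne
  have h1 := (ENNReal.tendsto_toReal ENNReal.zero_ne_top).comp h0
  rw [tendsto_zero_iff_abs_tendsto_zero]
  have h2 := (Real.continuous_sqrt.tendsto 0).comp h1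
  simpa [Function.comp_def, Real.sqrt_sq_eq_abs, ENNReal.toReal_ofReal, sq_nonneg] using h2

theorem eventually_pow_succ_le (e : ℕ) {a : ℝ} (ha : 1 < a) :
    ∀ᶠ k : ℕ in atTop, (((k + 1 + 1) ^ e : ℕ) : ℝ) ≤ a * ((k + 1) ^ e : ℕ) := by
  have h1 : Tendsto (fun k : ℕ => (1 + 1 / ((k : ℝ) + 1)) ^ e) atTop (𝓝 ((1 + 0) ^ e)) :=
    (tendsto_one_div_add_atTop_nhds_zero_nat.const_add 1).pow e
  simp only [add_zero, one_pow] at h1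
  filter_upwards [h1.eventually (ge_mem_nhds ha)] with k hk
  have hk0 : (0 : ℝ) < k + 1 := by positivity
  push_cast
  calc ((k : ℝ) + 1 + 1) ^ e = (1 + 1 / ((k : ℝ) + 1)) ^ e * (k + 1) ^ e := by
        rw [← mul_pow]
        congr 1
        field_simp
    _ ≤ _ := by gcongr

theorem tendsto_div_of_strictMonoOn {u φ : ℝ → ℝ} {l : ℝ} (hu : MonotoneOn u (Set.Ici 1))
    (hu0 : ∀ t, 1 ≤ t → 0 ≤ u t)
    (hφ : StrictMonoOn φ (Set.Ici 1)) (hφtop : Tendsto φ atTop atTop) {τ : ℕ → ℝ}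
    (hτ : ∀ j, 1 ≤ τ j) (hφτ : ∀ j, φ (τ j) = j) {e : ℕ} (he : e ≠ 0)
    (h : Tendsto (fun k : ℕ => u (τ ((k + 1) ^ e)) / ((k + 1) ^ e : ℕ)) atTop (𝓝 l)) :
    Tendsto (fun t => u t / φ t) atTop (𝓝 l) := by
  have hseq : Tendsto (fun j : ℕ => u (τ j) / j) atTop (𝓝 l) := by
    refine tendsto_div_of_monotone_of_exists_subseq_tendsto_div (fun j => u (τ j)) l
      (fun i j hij => hu (hτ i) (hτ j) ((hφ.le_iff_le (hτ i) (hτ j)).1 ?_)) fun a ha =>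
        ⟨fun k => (k + 1) ^ e, eventually_pow_succ_le e ha, ?_, h⟩
    · rw [hφτ, hφτ]
      exact_mod_cast hij
    · exact (tendsto_pow_atTop he).comp (tendsto_add_atTop_nat 1)
  have hfl : Tendsto (fun t => ⌊φ t⌋₊) atTop atTop := tendsto_nat_floor_atTop.comp hφtop
  have hr : Tendsto (fun j : ℕ => (j : ℝ) / (j + 1)) atTop (𝓝 1) := by
    simpa using tendsto_natCast_div_add_atTop (1 : ℝ)
  have hlow : Tendsto (fun j : ℕ => u (τ j) / j * (j / (j + 1))) atTop (𝓝 l) := by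
    simpa using hseq.mul hr
  have hup : Tendsto (fun j : ℕ => u (τ (j + 1)) / (j + 1 : ℕ) * (j / (j + 1) : ℝ)⁻¹) atTop
      (𝓝 l) := by
    simpa using (hseq.comp (tendsto_add_atTop_nat 1)).mul (hr.inv₀ one_ne_zero)
  refine tendsto_of_tendsto_of_tendsto_of_le_of_le' (hlow.comp hfl) (hup.comp hfl) ?_ ?_
  · filter_upwards [hφtop.eventually_ge_atTop 1, eventually_ge_atTop 1] with t h1 ht
    have hj : 0 < ⌊φ t⌋₊ := Nat.floor_pos.2 h1
    have hj' : (0 : ℝ) < ⌊φ t⌋₊ := by exact_mod_cast hj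
    have hle : τ ⌊φ t⌋₊ ≤ t := by
      rw [← hφ.le_iff_le (hτ _) ht, hφτ]
      exact Nat.floor_le (by linarith)
    have hlt := Nat.lt_floor_add_one (φ t)
    simp only [Function.comp]
    rw [div_mul_div_cancel₀ hj'.ne']
    exact div_le_div₀ (hu0 t ht) (hu (hτ _) ht hle) (by linarith) hlt.le
  · filter_upwards [hφtop.eventually_ge_atTop 1, eventually_ge_atTop 1] with t h1 ht
    have hj : 0 < ⌊φ t⌋₊ := Nat.floor_pos.2 h1
    have hj' : (0 : ℝ) < ⌊φ t⌋₊ := by exact_mod_cast hj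
    have hlt := Nat.lt_floor_add_one (φ t)
    have hle : t ≤ τ (⌊φ t⌋₊ + 1) := by
      rw [← hφ.le_iff_le ht (hτ _), hφτ]
      exact_mod_cast hlt.le
    simp only [Function.comp]
    rw [inv_div]
    push_cast
    rw [div_mul_div_cancel₀ (by positivity)]
    exact div_le_div₀ (hu0 _ (hτ _)) (hu ht (hτ _) hle) hj' (Nat.floor_le (by linarith))

theorem ae_tendsto_div_of_lintegral_sq_le {Ω : Type*} [MeasurableSpace Ω] {μ : Measure Ω}
    [IsFiniteMeasure μ] {X : ℝ → Ω → ℝ≥0∞} {s φ : ℝ → ℝ} {c σ A B M : ℝ} {p : ℕ}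
    (hX : ∀ T, Measurable (X T)) (hmono : ∀ x, Monotone fun T => X T x)
    (hs : ∀ T, 0 ≤ s T) (hc : 0 ≤ c) (hA : 0 ≤ A) (hB : 0 ≤ B) (hM : 0 ≤ M)
    (hφ : StrictMonoOn φ (Set.Ici 1)) (hφtop : Tendsto φ atTop atTop)
    (hφc : ContinuousOn φ (Set.Ici 1)) (hφ1 : φ 1 = 0)
    (h1 : ∀ T, 1 ≤ T → ∫⁻ x, X T x ∂μ = ENNReal.ofReal (c * s T) * μ Set.univ)
    (h2 : ∀ T, 1 ≤ T → ∀ K : ℕ, 1 ≤ K → ∫⁻ x, X T x ^ 2 ∂μ ≤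
      ENNReal.ofReal (c ^ 2 * ((1 + A / K) * s T ^ 2 + K ^ p * (B * (φ T + 1)))) * μ Set.univ)
    (hsM : ∀ T, 1 ≤ T → s T ≤ M * (φ T + 1))
    (hsσ : Tendsto (fun T => s T / φ T) atTop (𝓝 σ)) :
    ∀ᵐ x ∂μ, (∀ T, X T x < ⊤) ∧ Tendsto (fun T => (X T x).toReal / φ T) atTop (𝓝 (c * σ)) := by
  have hsurj (j : ℕ) : ∃ t, 1 ≤ t ∧ φ t = j := by
    obtain ⟨b, hb1, hb⟩ := (((eventually_ge_atTop 1).and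
      (hφtop.eventually_ge_atTop (j : ℝ))).exists)
    obtain ⟨t, ht, e⟩ := intermediate_value_Icc hb1 (hφc.mono Set.Icc_subset_Ici_self)
      ⟨by rw [hφ1]; positivity, hb⟩
    exact ⟨t, ht.1, e⟩
  choose τ hτ hφτ using hsurj
  set e := 2 * p + 2
  set N : ℕ → ℝ := fun k => τ ((k + 1) ^ e)
  have hφN (k : ℕ) : φ (N k) = ((k : ℝ) + 1) ^ e := by simp [N, hφτ]
  have hN (k : ℕ) : 1 ≤ N k := hτ _
  have hNtop : Tendsto N atTop atTop := by
    refine tendsto_atTop.2 fun b => ?_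
    have h3 : Tendsto (fun k : ℕ => φ (N k)) atTop atTop := by
      simp only [hφN]
      exact (tendsto_pow_atTop (by omega)).comp
        (tendsto_atTop_add_const_right _ 1 tendsto_natCast_atTop_atTop)
    filter_upwards [h3.eventually_ge_atTop (φ (max b 1))] with k hk
    exact (le_max_left _ _).trans ((hφ.le_iff_le (Set.mem_Ici.2 (le_max_right _ _)) (hN k)).1 hk)
  have hvar (k : ℕ) : ∫⁻ x, ENNReal.ofReal ((((X (N k) x).toReal - c * s (N k)) / φ (N k)) ^ 2) ∂μ ≤
      ENNReal.ofReal (c ^ 2 * (4 * A * M ^ 2 + 2 * B) * ((k + 1 : ℝ) ^ 2)⁻¹) * μ Set.univ := by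
    have hk : (1 : ℝ) ≤ (k : ℝ) + 1 := by linarith [k.cast_nonneg (α := ℝ)]
    have hφ1 : 1 ≤ φ (N k) := by rw [hφN]; exact one_le_pow₀ hk
    have hφ0 : 0 < φ (N k) := by linarith
    have hsk : s (N k) ≤ 2 * M * φ (N k) := (hsM _ (hN k)).trans (by nlinarith)
    set v : ℝ := c ^ 2 * (A / ((k + 1) ^ 2 : ℕ) * s (N k) ^ 2 +
      ((k + 1) ^ 2 : ℕ) ^ p * (B * (φ (N k) + 1))) with hv
    have hv0 : 0 ≤ v := by positivity
    have key := lintegral_sq_sub_le (hX (N k)) (mul_nonneg hc (hs _)) hv0 (h1 _ (hN k))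
      (by
        convert h2 _ (hN k) ((k + 1) ^ 2) (Nat.one_le_pow _ _ (by omega)) using 3
        rw [hv]
        ring)
    have hv1 : v / φ (N k) ^ 2 ≤ c ^ 2 * (4 * A * M ^ 2 + 2 * B) * ((k + 1 : ℝ) ^ 2)⁻¹ := by
      rw [div_le_iff₀ (by positivity), hv, mul_assoc, mul_assoc]
      gcongr
      push_cast
      have e1 : s (N k) ^ 2 ≤ (2 * M * φ (N k)) ^ 2 := by
        gcongr
        exact hs _
      have e2 : ((k : ℝ) + 1) ^ 2 * (((k : ℝ) + 1) ^ 2) ^ p = φ (N k) := by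
        rw [hφN, ← pow_mul, ← pow_add]
        congr 1
        omega
      have e3 : (((k : ℝ) + 1) ^ 2) ^ p = φ (N k) * (((k : ℝ) + 1) ^ 2)⁻¹ := by
        rw [← e2]
        field_simp
      calc _ ≤ A / ((k : ℝ) + 1) ^ 2 * (2 * M * φ (N k)) ^ 2 +
            φ (N k) * (((k : ℝ) + 1) ^ 2)⁻¹ * (B * (φ (N k) + φ (N k))) := by
            rw [e3]
            gcongr
        _ = _ := by
            field_simp
            ring
    calc _ = ENNReal.ofReal (φ (N k) ^ 2)⁻¹ *
          ∫⁻ x, ENNReal.ofReal (((X (N k) x).toReal - c * s (N k)) ^ 2) ∂μ := by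
          rw [← lintegral_const_mul _ (by have := hX (N k); fun_prop)]
          refine lintegral_congr fun x => ?_
          rw [← ENNReal.ofReal_mul (by positivity)]
          congr 1
          field_simp
      _ ≤ ENNReal.ofReal (φ (N k) ^ 2)⁻¹ * (ENNReal.ofReal v * μ Set.univ) := by gcongr
      _ ≤ _ := by
          rw [← mul_assoc, ← ENNReal.ofReal_mul (by positivity), inv_mul_eq_div]
          gcongr
  have hae := ae_tendsto_zero_of_lintegral_sq_le
    (fun k => ((hX (N k)).ennreal_toReal.sub_const (c * s (N k))).div_const (φ (N k))) hvar
  have hfin : ∀ᵐ x ∂μ, ∀ j : ℕ, X (τ j) x < ⊤ := by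
    rw [ae_all_iff]
    exact fun j => ae_lt_top (hX _) (by rw [h1 _ (hτ j)]; finiteness)
  filter_upwards [hae, hfin] with x hx hxfin
  have hlt (T : ℝ) : X T x < ⊤ := by
    obtain ⟨j, hj⟩ := exists_nat_ge (φ (max T 1))
    rw [← hφτ j, hφ.le_iff_le (Set.mem_Ici.2 (le_max_right _ _)) (hτ j)] at hj
    exact (hmono x ((le_max_left _ _).trans hj)).trans_lt (hxfin j)
  refine ⟨hlt, tendsto_div_of_strictMonoOn (fun a _ b _ hab =>
    ENNReal.toReal_mono (hlt b).ne (hmono x hab)) (fun t _ => ENNReal.toReal_nonneg) hφ hφtop hτ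
      hφτ (e := e) (by omega) ?_⟩
  have h3 : Tendsto (fun k => c * (s (N k) / φ (N k))) atTop (𝓝 (c * σ)) :=
    (hsσ.comp hNtop).const_mul c
  have h4 := hx.add h3
  rw [zero_add] at h4
  refine h4.congr fun k => ?_
  rw [← hφτ ((k + 1) ^ e)]
  simp only [N]
  ring

end Asymptotics

section Primitive

variable {ψ : ℝ → ℝ}

theorem tendsto_div_one_of_le {f φ : ℝ → ℝ} {A : ℝ} (hA : 0 ≤ A)
    (hφ : Tendsto φ atTop atTop) (h : ∀ K : ℕ, 1 ≤ K → ∃ C : ℝ, ∀ T, 1 ≤ T →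
      f T ≤ (1 + A / K) * φ T + C ∧ φ T ≤ (1 + A / K) * f T + C) :
    Tendsto (fun T => f T / φ T) atTop (𝓝 1) := by
  have hK : Tendsto (fun K : ℕ => 1 + A / K) atTop (𝓝 1) := by
    simpa using (tendsto_const_div_atTop_nhds_zero_nat A).const_add 1
  have hC (C : ℝ) : Tendsto (fun T => C / φ T) atTop (𝓝 0) := hφ.const_div_atTop C
  refine tendsto_order.2 ⟨fun b hb => ?_, fun b hb => ?_⟩
  · have hK' : Tendsto (fun K : ℕ => (1 + A / (K : ℝ))⁻¹) atTop (𝓝 1) := by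
      simpa using hK.inv₀ one_ne_zero
    obtain ⟨K, hK1, hKb⟩ := ((eventually_ge_atTop 1).and (hK'.eventually (lt_mem_nhds hb))).exists
    obtain ⟨C, hCK⟩ := h K hK1
    have h1 : Tendsto (fun T => (1 - C / φ T) * (1 + A / K)⁻¹) atTop (𝓝 ((1 - 0) * (1 + A / K)⁻¹)) :=
      ((hC C).const_sub 1).mul_const _
    rw [sub_zero, one_mul] at h1
    filter_upwards [h1.eventually (lt_mem_nhds hKb), eventually_ge_atTop 1,
      hφ.eventually_gt_atTop 0] with T h2 hT hφT
    refine h2.trans_le ?_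
    rw [← div_eq_mul_inv, div_le_iff₀ (by positivity), one_sub_div hφT.ne', div_mul_eq_mul_div]
    gcongr
    linarith [(hCK T hT).2]
  · obtain ⟨K, hK1, hKb⟩ := ((eventually_ge_atTop 1).and (hK.eventually (gt_mem_nhds hb))).exists
    obtain ⟨C, hCK⟩ := h K hK1
    have h1 : Tendsto (fun T => (1 + A / K) + C / φ T) atTop (𝓝 ((1 + A / K) + 0)) :=
      (hC C).const_add _
    rw [add_zero] at h1
    filter_upwards [h1.eventually (gt_mem_nhds hKb), eventually_ge_atTop 1,
      hφ.eventually_gt_atTop 0] with T h2 hT hφT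
    refine lt_of_le_of_lt ?_ h2
    rw [div_le_iff₀ hφT, add_mul, div_mul_cancel₀ _ hφT.ne']
    exact (hCK T hT).1

theorem intervalIntegrable_of_antitoneOn (hψ : AntitoneOn ψ (Set.Ici 1)) {a b : ℝ} (ha : 1 ≤ a)
    (hb : 1 ≤ b) : IntervalIntegrable ψ volume a b :=
  (hψ.mono ((Set.ordConnected_Ici.uIcc_subset ha hb))).intervalIntegrable

theorem integral_sub_integral (hψ : AntitoneOn ψ (Set.Ici 1)) {a b : ℝ} (ha : 1 ≤ a)
    (hb : 1 ≤ b) : (∫ t in 1..b, ψ t) - ∫ t in 1..a, ψ t = ∫ t in a..b, ψ t :=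
  intervalIntegral.integral_interval_sub_left
    (intervalIntegrable_of_antitoneOn hψ le_rfl hb) (intervalIntegrable_of_antitoneOn hψ le_rfl ha)

theorem strictMonoOn_integral (hψ : AntitoneOn ψ (Set.Ici 1)) (hpos : ∀ t, 1 ≤ t → 0 < ψ t) :
    StrictMonoOn (fun T => ∫ t in 1..T, ψ t) (Set.Ici 1) := by
  intro a ha b hb hab
  rw [← sub_pos, integral_sub_integral hψ ha hb]
  exact intervalIntegral.intervalIntegral_pos_of_pos_on (intervalIntegrable_of_antitoneOn hψ ha hb)
    (fun x hx => hpos x (le_trans ha hx.1.le)) hab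

theorem continuousOn_integral (hψ : AntitoneOn ψ (Set.Ici 1)) (hpos : ∀ t, 1 ≤ t → 0 < ψ t) :
    ContinuousOn (fun T => ∫ t in 1..T, ψ t) (Set.Ici 1) := by
  refine (LipschitzOnWith.of_dist_le_mul (K := (ψ 1).toNNReal) fun b hb a ha => ?_).continuousOn
  rw [Real.dist_eq, integral_sub_integral hψ ha hb, Real.coe_toNNReal _ (hpos 1 le_rfl).le,
    Real.dist_eq, ← Real.norm_eq_abs]
  refine intervalIntegral.norm_integral_le_of_norm_le_const fun x hx => ?_
  have hx1 : 1 ≤ x := (Set.ordConnected_Ici.uIcc_subset ha hb) (Set.uIoc_subset_uIcc hx)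
  rw [Real.norm_of_nonneg (hpos x hx1).le]
  exact hψ (Set.mem_Ici.2 le_rfl) hx1 hx1

theorem integral_nonneg_of_pos (hψ : AntitoneOn ψ (Set.Ici 1)) (hpos : ∀ t, 1 ≤ t → 0 < ψ t)
    {T : ℝ} (hT : 1 ≤ T) : 0 ≤ ∫ t in 1..T, ψ t := by
  simpa using (strictMonoOn_integral hψ hpos).monotoneOn (Set.mem_Ici.2 le_rfl) hT hT

theorem tendsto_volume_Einf_div {m n : ℕ} (hm : 1 ≤ m) (hn : 1 ≤ n)
    (hψ : AntitoneOn ψ (Set.Ici 1)) (hpos : ∀ t, 1 ≤ t → 0 < ψ t)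
    (hdiv : Tendsto (fun T : ℝ => ∫ t in (1 : ℝ)..T, ψ t) atTop atTop) :
    Tendsto (fun T => (volume (Einf m n ψ T)).toReal / ∫ t in (1 : ℝ)..T, ψ t) atTop
      (𝓝 (Real.pi ^ (m + n))) := by
  have hpi := Real.pi_pos
  have h1 : Tendsto (fun T => ((volume (Einf m n ψ T)).toReal / Real.pi ^ (m + n)) /
      ∫ t in (1 : ℝ)..T, ψ t) atTop (𝓝 1) := by
    refine tendsto_div_one_of_le le_rfl hdiv fun K _ => ⟨ψ 1, fun T hT => ?_⟩
    have h0 := integral_nonneg_of_pos hψ hpos hT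
    have h1 := volume_Einf_le hm hn hψ hpos T
    have h2 := le_volume_Einf hm hn hψ hpos T
    have hψ1 := (hpos 1 le_rfl).le
    rw [lintegral_weight_of_antitoneOn hψ hpos hT, ← ENNReal.ofReal_add h0 hψ1,
      ← ENNReal.ofReal_pow hpi.le, ← ENNReal.ofReal_mul (by positivity)] at h1
    rw [lintegral_weight_of_antitoneOn hψ hpos hT, ← ENNReal.ofReal_pow hpi.le,
      ← ENNReal.ofReal_mul (by positivity), ← ENNReal.ofReal_mul (by positivity),
      ← ENNReal.ofReal_toReal (h1.trans_lt ENNReal.ofReal_lt_top).ne,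
      ← ENNReal.ofReal_add (by positivity) (by positivity),
      ENNReal.ofReal_le_ofReal_iff (by positivity)] at h2
    have h3 := ENNReal.toReal_le_of_le_ofReal (by positivity) h1
    simp only [zero_div, add_zero, one_mul]
    rw [div_le_iff₀ (by positivity), div_add' _ _ _ (by positivity), le_div_iff₀ (by positivity)]
    constructor <;> linarith
  have h2 := h1.const_mul (Real.pi ^ (m + n))
  rw [mul_one] at h2
  refine h2.congr fun T => ?_
  field_simp

end Primitive

section Main

variable {O : Subring ℂ} {Λ : AddSubgroup ℂ} {D : Set ℂ} {Δ : ℝ} {m n : ℕ} {ψ : ℝ → ℝ}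

theorem monotone_solutions (Λ : AddSubgroup ℂ) (ψ : ℝ → ℝ) (a : Fin m → ℂ) (w : Fin n → ℂ)
    (θ : Fin m → Fin n → ℂ) : Monotone fun T => solutions Λ ψ a w T θ := by
  intro T T' hT
  exact ENNReal.tsum_le_tsum fun l =>
    Set.indicator_le_indicator_of_subset (Set.Ico_subset_Ico_right hT) (fun _ => zero_le) _

namespace IsIdealLattice

theorem denomWeight_bounds (h : IsIdealLattice O Λ D Δ) (hn : 1 ≤ n) (w : Fin n → ℂ)
    (hψ : AntitoneOn ψ (Set.Ici 1)) (hpos : ∀ t, 1 ≤ t → 0 < ψ t) {K : ℕ} (hK : 1 ≤ K) :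
    ∃ C : ℝ, ∀ T, 1 ≤ T → denomWeight Λ ψ w T ≠ ⊤ ∧
      ((volume D).toReal / Real.pi) ^ n * (denomWeight Λ ψ w T).toReal ≤
        (1 + 2 ^ (2 * n) / K) * (∫ t in 1..T, ψ t) + C ∧
      ∫ t in 1..T, ψ t ≤ (1 + 2 ^ (2 * n) / K) *
        (((volume D).toReal / Real.pi) ^ n * (denomWeight Λ ψ w T).toReal) + C := by
  obtain ⟨C₁, hC₁, h₁⟩ := volume_mul_tsum_weight_le h.isTile h.pos.le h.coveredBy hn w hψ hpos hK
  obtain ⟨C₂, hC₂, h₂⟩ :=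
    lintegral_le_volume_mul_tsum_weight h.isTile h.pos.le h.coveredBy hn w hψ hpos hK
  have hpi := Real.pi_pos
  have hV : 0 < (volume D).toReal := ENNReal.toReal_pos h.volume_ne_zero h.volume_ne_top
  have hVn : volume D ^ n ≠ 0 := pow_ne_zero _ h.volume_ne_zero
  have hK0 : (0 : ℝ) < K := by exact_mod_cast hK
  have hA : (1 + 2 ^ (2 * n) / (K : ℝ≥0∞)) = ENNReal.ofReal (1 + 2 ^ (2 * n) / K) := by
    rw [ENNReal.ofReal_add (by positivity) (by positivity), ENNReal.ofReal_div_of_pos hK0]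
    simp [ENNReal.ofReal_pow]
  refine ⟨(C₁.toReal + C₂.toReal) / Real.pi ^ n, fun T hT => ?_⟩
  have h0 := integral_nonneg_of_pos hψ hpos hT
  have h₁ := h₁ T
  have h₂ := h₂ T
  rw [lintegral_weight_of_antitoneOn hψ hpos hT, hA, ← ENNReal.ofReal_pow hpi.le] at h₁ h₂
  have hS : denomWeight Λ ψ w T ≠ ⊤ := by
    intro e
    change volume D ^ n * denomWeight Λ ψ w T ≤ _ at h₁
    rw [e, ENNReal.mul_top hVn, top_le_iff] at h₁
    exact absurd h₁ (by finiteness)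
  have e : volume D ^ n * ∑' l : piSubgroup (Fin n) Λ, weight ψ T (‖w + l‖ ^ (2 * n)) =
      ENNReal.ofReal ((volume D).toReal ^ n * (denomWeight Λ ψ w T).toReal) := by
    rw [ENNReal.ofReal_mul (by positivity), ENNReal.ofReal_pow hV.le,
      ENNReal.ofReal_toReal h.volume_ne_top, ENNReal.ofReal_toReal hS, denomWeight]
  rw [e, ← ENNReal.ofReal_toReal hC₁, ← ENNReal.ofReal_mul (by positivity),
    ← ENNReal.ofReal_mul (by positivity), ← ENNReal.ofReal_add (by positivity) (by positivity),
    ENNReal.ofReal_le_ofReal_iff (by positivity)] at h₁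
  rw [e, ← ENNReal.ofReal_toReal hC₂, ← ENNReal.ofReal_mul (by positivity),
    ← ENNReal.ofReal_mul (by positivity), ← ENNReal.ofReal_add (by positivity) (by positivity),
    ENNReal.ofReal_le_ofReal_iff (by positivity)] at h₂
  have hC₁0 : 0 ≤ C₁.toReal := ENNReal.toReal_nonneg
  have hC₂0 : 0 ≤ C₂.toReal := ENNReal.toReal_nonneg
  refine ⟨hS, ?_, ?_⟩
  · rw [div_pow, div_mul_eq_mul_div, ← sub_nonneg]
    have : 0 ≤ (Real.pi ^ n * (1 + 2 ^ (2 * n) / K) * (∫ t in 1..T, ψ t) + (C₁.toReal + C₂.toReal) -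
      (volume D).toReal ^ n * (denomWeight Λ ψ w T).toReal) / Real.pi ^ n :=
      div_nonneg (by linarith) (by positivity)
    refine this.trans_eq ?_
    field_simp
  · rw [div_pow, div_mul_eq_mul_div, ← sub_nonneg]
    have : 0 ≤ ((1 + 2 ^ (2 * n) / K) * ((volume D).toReal ^ n * (denomWeight Λ ψ w T).toReal) +
      (C₁.toReal + C₂.toReal) - Real.pi ^ n * (∫ t in 1..T, ψ t)) / Real.pi ^ n :=
      div_nonneg (by linarith) (by positivity)
    refine this.trans_eq ?_
    field_simp

end IsIdealLattice

end Main

section AlmostEverywhere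

variable {O : Subring ℂ} {Λ : AddSubgroup ℂ} {D : Set ℂ} {Δ : ℝ} {m n : ℕ} {ψ : ℝ → ℝ}

namespace IsIdealLattice

theorem tendsto_denomWeight_div (h : IsIdealLattice O Λ D Δ) (hn : 1 ≤ n) (w : Fin n → ℂ)
    (hψ : AntitoneOn ψ (Set.Ici 1)) (hpos : ∀ t, 1 ≤ t → 0 < ψ t)
    (hdiv : Tendsto (fun T : ℝ => ∫ t in (1 : ℝ)..T, ψ t) atTop atTop) :
    Tendsto (fun T => (denomWeight Λ ψ w T).toReal / ∫ t in (1 : ℝ)..T, ψ t) atTop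
      (𝓝 ((Real.pi / (volume D).toReal) ^ n)) := by
  have hpi := Real.pi_pos
  have hV : 0 < (volume D).toReal := ENNReal.toReal_pos h.volume_ne_zero h.volume_ne_top
  have h1 := tendsto_div_one_of_le (A := 2 ^ (2 * n)) (by positivity) hdiv fun K hK =>
    let ⟨C, hC⟩ := h.denomWeight_bounds hn w hψ hpos hK
    ⟨C, fun T hT => (hC T hT).2⟩
  have h2 := h1.const_mul ((Real.pi / (volume D).toReal) ^ n)
  rw [mul_one] at h2
  refine h2.congr fun T => ?_
  rw [mul_div_assoc, ← mul_assoc, ← mul_pow, div_mul_div_cancel₀ hV.ne', div_self hpi.ne',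
    one_pow, one_mul]

theorem volume_pow_mul_ofReal (h : IsIdealLattice O Λ D Δ) {x : ℝ} (hx : 0 ≤ x) (k : ℕ) :
    volume D ^ k * ENNReal.ofReal ((x / (volume D).toReal) ^ k) = ENNReal.ofReal x ^ k := by
  have hV : 0 < (volume D).toReal := ENNReal.toReal_pos h.volume_ne_zero h.volume_ne_top
  rw [ENNReal.ofReal_pow (by positivity), ← mul_pow, ENNReal.ofReal_div_of_pos hV,
    ENNReal.ofReal_toReal h.volume_ne_top, ENNReal.mul_div_cancel h.volume_ne_zero h.volume_ne_top]

theorem lintegral_solutions_eq_ofReal (h : IsIdealLattice O Λ D Δ) (hm : 1 ≤ m) (hn : 1 ≤ n)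
    (hψ : AntitoneOn ψ (Set.Ici 1)) (hpos : ∀ t, 1 ≤ t → 0 < ψ t) (a : Fin m → ℂ) {w : Fin n → ℂ}
    (hw : ∀ j, w j ∈ O) {T : ℝ} (hT : 1 ≤ T) :
    ∫⁻ θ in Set.univ.pi fun _ : Fin m => Set.univ.pi fun _ : Fin n => D, solutions Λ ψ a w T θ =
      ENNReal.ofReal ((Real.pi / (volume D).toReal) ^ m * (denomWeight Λ ψ w T).toReal) *
        volume (Set.univ.pi fun _ : Fin m => Set.univ.pi fun _ : Fin n => D) := by
  have hpi := Real.pi_pos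
  have hV : 0 < (volume D).toReal := ENNReal.toReal_pos h.volume_ne_zero h.volume_ne_top
  obtain ⟨C, hC⟩ := h.denomWeight_bounds hn w hψ hpos le_rfl
  have h1 := h.lintegral_solutions hm hn hpos a hw T
  have hVm : volume D ^ m ≠ 0 := pow_ne_zero _ h.volume_ne_zero
  rw [← (ENNReal.mul_right_inj hVm (by have := h.volume_ne_top; finiteness)), h1, ← mul_assoc,
    ENNReal.ofReal_mul (by positivity), ENNReal.ofReal_toReal (hC T hT).1, ← mul_assoc]
  congr 2
  exact (h.volume_pow_mul_ofReal hpi.le m).symm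

theorem lintegral_solutions_sq_le_ofReal (h : IsIdealLattice O Λ D Δ) (hm : 1 ≤ m) (hn : 1 ≤ n)
    (hd : 3 ≤ m + n) (hψ : AntitoneOn ψ (Set.Ici 1)) (hpos : ∀ t, 1 ≤ t → 0 < ψ t)
    (a : Fin m → ℂ) {w : Fin n → ℂ} (hw : ∀ j, w j ∈ O) {T : ℝ} (hT : 1 ≤ T) {K : ℕ}
    (hK : 1 ≤ K) :
    ∫⁻ θ in Set.univ.pi fun _ : Fin m => Set.univ.pi fun _ : Fin n => D,
        solutions Λ ψ a w T θ ^ 2 ≤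
      ENNReal.ofReal (((Real.pi / (volume D).toReal) ^ m) ^ 2 *
        ((1 + 2 ^ (2 * m) / K) * (denomWeight Λ ψ w T).toReal ^ 2 + (K : ℝ) ^ (2 * m) *
          (2 ^ (2 * m) * (360 * coverConst D Δ ^ (2 * m) * 9 ^ n) * (1 + ψ 1) *
            ((∫ t in (1 : ℝ)..T, ψ t) + 1)))) *
        volume (Set.univ.pi fun _ : Fin m => Set.univ.pi fun _ : Fin n => D) := by
  have hpi := Real.pi_pos
  have hV : 0 < (volume D).toReal := ENNReal.toReal_pos h.volume_ne_zero h.volume_ne_top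
  have hK0 : (0 : ℝ) < K := by exact_mod_cast hK
  have hψ1 := hpos 1 le_rfl
  have hcc := h.coverConst_nonneg
  have hφ := integral_nonneg_of_pos hψ hpos hT
  obtain ⟨C, hC⟩ := h.denomWeight_bounds hn w hψ hpos le_rfl
  have h1 := h.lintegral_solutions_sq_le hm hn hd hψ hpos a hw T hK
  have hVm : volume D ^ (2 * m) ≠ 0 := pow_ne_zero _ h.volume_ne_zero
  have hA : (1 + 2 ^ (2 * m) / (K : ℝ≥0∞)) = ENNReal.ofReal (1 + 2 ^ (2 * m) / K) := by
    rw [ENNReal.ofReal_add (by positivity) (by positivity), ENNReal.ofReal_div_of_pos hK0]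
    simp [ENNReal.ofReal_pow]
  have h360 : (360 : ℝ≥0∞) = ENNReal.ofReal 360 := by simp
  have h9 : (9 : ℝ≥0∞) = ENNReal.ofReal 9 := by simp
  have h2K : (2 * K : ℝ≥0∞) = ENNReal.ofReal (2 * K) := by
    rw [ENNReal.ofReal_mul (by norm_num)]
    simp
  rw [← ENNReal.mul_le_mul_iff_right hVm (by have := h.volume_ne_top; finiteness)]
  refine h1.trans ?_
  rw [← pow_mul, mul_comm m 2,
    ENNReal.ofReal_mul (p := (Real.pi / (volume D).toReal) ^ (2 * m)) (by positivity),
    mul_assoc (ENNReal.ofReal ((Real.pi / (volume D).toReal) ^ (2 * m))),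
    ← mul_assoc (volume D ^ (2 * m)), h.volume_pow_mul_ofReal hpi.le,
    mul_right_comm (ENNReal.ofReal Real.pi ^ (2 * m)) (volume _),
    mul_assoc (ENNReal.ofReal Real.pi ^ (2 * m)),
    lintegral_weight_of_antitoneOn hψ hpos hT, hA, h360, h9, h2K,
    ← ENNReal.ofReal_toReal (hC T hT).1, ENNReal.toReal_ofReal ENNReal.toReal_nonneg]
  gcongr
  rw [← ENNReal.ofReal_add (by positivity) (by positivity)]
  simp only [← ENNReal.ofReal_pow, ENNReal.toReal_nonneg, hcc, Nat.ofNat_nonneg,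
    mul_nonneg, Nat.cast_nonneg]
  rw [← ENNReal.ofReal_mul (by positivity), ← ENNReal.ofReal_mul (by positivity),
    ← ENNReal.ofReal_mul (by positivity), ← ENNReal.ofReal_mul (by positivity),
    ← ENNReal.ofReal_mul (by positivity), ← ENNReal.ofReal_add (by positivity) (by positivity)]
  apply ENNReal.ofReal_le_ofReal
  gcongr _ + ?_
  rw [mul_pow]
  calc _ = (K : ℝ) ^ (2 * m) * (2 ^ (2 * m) * (360 * coverConst D Δ ^ (2 * m) * 9 ^ n) *
        ((∫ t in (1 : ℝ)..T, ψ t) + ψ 1)) := by ring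
    _ ≤ (K : ℝ) ^ (2 * m) * (2 ^ (2 * m) * (360 * coverConst D Δ ^ (2 * m) * 9 ^ n) *
        ((1 + ψ 1) * ((∫ t in (1 : ℝ)..T, ψ t) + 1))) := by
        gcongr
        nlinarith
    _ = _ := by ring

theorem ae_restrict_tendsto (h : IsIdealLattice O Λ D Δ) (hm : 1 ≤ m) (hn : 1 ≤ n)
    (hd : 3 ≤ m + n) (hψ : AntitoneOn ψ (Set.Ici 1)) (hpos : ∀ t, 1 ≤ t → 0 < ψ t)
    (hdiv : Tendsto (fun T : ℝ => ∫ t in (1 : ℝ)..T, ψ t) atTop atTop)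
    (a : Fin m → ℂ) {w : Fin n → ℂ} (hw : ∀ j, w j ∈ O) :
    ∀ᵐ θ ∂volume.restrict (Set.univ.pi fun _ : Fin m => Set.univ.pi fun _ : Fin n => D),
      (∀ T, solutions Λ ψ a w T θ < ⊤) ∧
      Tendsto (fun T => (solutions Λ ψ a w T θ).toReal / ∫ t in (1 : ℝ)..T, ψ t) atTop
        (𝓝 ((Real.pi / (volume D).toReal) ^ m * (Real.pi / (volume D).toReal) ^ n)) := by
  have hpi := Real.pi_pos
  have hV : 0 < (volume D).toReal := ENNReal.toReal_pos h.volume_ne_zero h.volume_ne_top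
  have hψ1 := hpos 1 le_rfl
  have hcc := h.coverConst_nonneg
  have hfin : IsFiniteMeasure (volume.restrict
      (Set.univ.pi fun _ : Fin m => Set.univ.pi fun _ : Fin n => D)) := by
    refine isFiniteMeasure_restrict.2 ?_
    rw [volume_pi_pi]
    simp only [volume_univ_pi, Finset.prod_const]
    have := h.volume_ne_top
    finiteness
  obtain ⟨C, hC⟩ := h.denomWeight_bounds hn w hψ hpos le_rfl
  refine ae_tendsto_div_of_lintegral_sq_le (s := fun T => (denomWeight Λ ψ w T).toReal)
    (φ := fun T => ∫ t in (1 : ℝ)..T, ψ t) (A := 2 ^ (2 * m)) (p := 2 * m)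
    (B := 2 ^ (2 * m) * (360 * coverConst D Δ ^ (2 * m) * 9 ^ n) * (1 + ψ 1))
    (M := (Real.pi / (volume D).toReal) ^ n * ((1 + 2 ^ (2 * n)) + |C|))
    (fun T => h.measurable_solutions a w T) (monotone_solutions Λ ψ a w)
    (fun T => ENNReal.toReal_nonneg) (by positivity) (by positivity) (by positivity)
    (by positivity) (strictMonoOn_integral hψ hpos) hdiv (continuousOn_integral hψ hpos)
    intervalIntegral.integral_same (fun T hT => ?_) (fun T hT K hK => ?_) (fun T hT => ?_)
    (h.tendsto_denomWeight_div hn w hψ hpos hdiv)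
  · rw [Measure.restrict_apply_univ]
    exact h.lintegral_solutions_eq_ofReal hm hn hψ hpos a hw hT
  · rw [Measure.restrict_apply_univ]
    exact h.lintegral_solutions_sq_le_ofReal hm hn hd hψ hpos a hw hT hK
  · have hφ := integral_nonneg_of_pos hψ hpos hT
    have h1 := (hC T hT).2.1
    rw [Nat.cast_one, div_one, div_pow, div_mul_eq_mul_div, div_le_iff₀ (by positivity)] at h1
    rw [div_pow, div_mul_eq_mul_div, div_mul_eq_mul_div, le_div_iff₀ (by positivity)]
    refine (mul_comm _ _).trans_le (h1.trans ?_)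
    rw [mul_comm _ (Real.pi ^ n), mul_assoc]
    gcongr
    nlinarith [le_abs_self C, abs_nonneg C, mul_nonneg (abs_nonneg C) hφ,
      pow_pos (two_pos (α := ℝ)) (2 * n)]

theorem hitsBelow_mem_add (h : IsIdealLattice O Λ D Δ) (T : ℝ) (a : Fin m → ℂ) {q : Fin n → ℂ}
    (hq : ∀ j, q j ∈ O) {l : Fin m → Fin n → ℂ}
    (hl : l ∈ piSubgroup (Fin m) (piSubgroup (Fin n) Λ)) (θ : Fin m → Fin n → ℂ) :
    hitsBelow Λ ψ T a q (l + θ) = hitsBelow Λ ψ T a q θ := by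
  by_cases hqT : ‖q‖ ^ (2 * n) ∈ Set.Ico 1 T
  · simp only [hitsBelow, Set.indicator_of_mem hqT]
    exact hits_mem_add a (h.smul_mem hq) _ θ hl
  · simp only [hitsBelow, Set.indicator_of_notMem hqT]

theorem solutions_mem_add (h : IsIdealLattice O Λ D Δ) (a : Fin m → ℂ) {w : Fin n → ℂ}
    (hw : ∀ j, w j ∈ O) (T : ℝ) {l : Fin m → Fin n → ℂ}
    (hl : l ∈ piSubgroup (Fin m) (piSubgroup (Fin n) Λ)) (θ : Fin m → Fin n → ℂ) :
    solutions Λ ψ a w T (l + θ) = solutions Λ ψ a w T θ :=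
  tsum_congr fun k => h.hitsBelow_mem_add T a (h.add_mem hw k) hl θ

theorem ae_tendsto (h : IsIdealLattice O Λ D Δ) (hm : 1 ≤ m) (hn : 1 ≤ n)
    (hd : 3 ≤ m + n) (hψ : AntitoneOn ψ (Set.Ici 1)) (hpos : ∀ t, 1 ≤ t → 0 < ψ t)
    (hdiv : Tendsto (fun T : ℝ => ∫ t in (1 : ℝ)..T, ψ t) atTop atTop)
    (a : Fin m → ℂ) {w : Fin n → ℂ} (hw : ∀ j, w j ∈ O) :
    ∀ᵐ θ : Fin m → Fin n → ℂ, (∀ T, solutions Λ ψ a w T θ < ⊤) ∧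
      Tendsto (fun T => (solutions Λ ψ a w T θ).toReal / (volume (Einf m n ψ T)).toReal) atTop
        (𝓝 ((volume D).toReal⁻¹ ^ (m + n))) := by
  have hpi := Real.pi_pos
  have htile := (h.isTile.pi (ι := Fin n)).pi (ι := Fin m)
  have := htile.countable
  have h1 := h.ae_restrict_tendsto hm hn hd hψ hpos hdiv a hw
  rw [ae_restrict_iff' htile.measurableSet] at h1
  have h2 : ∀ᵐ θ : Fin m → Fin n → ℂ, ∀ l : piSubgroup (Fin m) (piSubgroup (Fin n) Λ),
      (l : Fin m → Fin n → ℂ) + θ ∈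
        (Set.univ.pi fun _ : Fin m => Set.univ.pi fun _ : Fin n => D) →
      (∀ T, solutions Λ ψ a w T (l + θ) < ⊤) ∧
      Tendsto (fun T => (solutions Λ ψ a w T (l + θ)).toReal / ∫ t in (1 : ℝ)..T, ψ t) atTop
        (𝓝 ((Real.pi / (volume D).toReal) ^ m * (Real.pi / (volume D).toReal) ^ n)) :=
    ae_all_iff.2 fun l =>
      (measurePreserving_add_left volume (l : Fin m → Fin n → ℂ)).quasiMeasurePreserving.ae h1
  filter_upwards [h2] with θ hθ
  obtain ⟨l, hl, -⟩ := htile.existsUnique θ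
  obtain ⟨h3, h4⟩ := hθ l hl
  simp only [h.solutions_mem_add a hw _ l.2] at h3 h4
  refine ⟨h3, ?_⟩
  have h5 := h4.div (tendsto_volume_Einf_div hm hn hψ hpos hdiv) (by positivity)
  have e : (Real.pi / (volume D).toReal) ^ m * (Real.pi / (volume D).toReal) ^ n /
      Real.pi ^ (m + n) = (volume D).toReal⁻¹ ^ (m + n) := by
    rw [← pow_add, ← div_pow]
    congr 1
    field_simp
  rw [e] at h5
  refine h5.congr' ?_
  filter_upwards [hdiv.eventually_gt_atTop 0] with T hT
  exact div_div_div_cancel_right₀ hT.ne' _ _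

end IsIdealLattice

end AlmostEverywhere

section IdealLattice

theorem Complex.volume_fundamentalDomain (b : Module.Basis (Fin 2) ℝ ℂ) :
    (volume (ZSpan.fundamentalDomain b)).toReal =
      |(b 0).re * (b 1).im - (b 1).re * (b 0).im| := by
  have h := ZSpan.measure_fundamentalDomain b volume Complex.orthonormalBasisOneI.toBasis
  rw [measure_congr (ZSpan.fundamentalDomain_ae_parallelepiped
    Complex.orthonormalBasisOneI.toBasis volume), OrthonormalBasis.coe_toBasis,
    OrthonormalBasis.volume_parallelepiped, mul_one] at h
  rw [h, ENNReal.toReal_ofReal (abs_nonneg _), Module.Basis.det_apply, Matrix.det_fin_two]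
  simp [Module.Basis.toMatrix_apply, Complex.orthonormalBasisOneI]

theorem isTile_fundamentalDomain (b : Module.Basis (Fin 2) ℝ ℂ) :
    IsTile (Submodule.span ℤ (Set.range b)).toAddSubgroup (ZSpan.fundamentalDomain b) where
  countable := inferInstanceAs (Countable (Submodule.span ℤ (Set.range b)))
  measurableSet := ZSpan.fundamentalDomain_measurableSet b
  existsUnique x := ZSpan.exist_unique_vadd_mem_fundamentalDomain b x

theorem exists_coveredBy_span (b : Module.Basis (Fin 2) ℝ ℂ) :
    ∃ Δ, 0 < Δ ∧ CoveredBy (Submodule.span ℤ (Set.range b)).toAddSubgroup Δ := by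
  obtain ⟨R, hR0, hR⟩ := (ZSpan.fundamentalDomain_isBounded b).exists_pos_norm_le
  refine ⟨R, hR0, fun y => ?_⟩
  obtain ⟨v, hv, -⟩ := ZSpan.exist_unique_vadd_mem_fundamentalDomain b y
  refine ⟨-(v : ℂ), neg_mem v.2, ?_⟩
  have := hR _ hv
  rwa [sub_neg_eq_add, add_comm]

variable {F : Type*} [Field F] {ι : F →+* ℂ}

variable (ι) in
/-- The embedding of the ring of integers induced by a complex embedding of the field. -/
def integersHom : 𝓞 F →+* ℂ := ι.comp (algebraMap (𝓞 F) F)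

theorem integersHom_injective : Function.Injective (integersHom ι) :=
  ι.injective.comp RingOfIntegers.coe_injective

theorem conj_ne_of_isEmpty (him : IsEmpty (F →+* ℝ)) :
    ComplexEmbedding.conjugate ι ≠ ι := fun h =>
  him.false (ComplexEmbedding.isReal_iff.2 h).embedding

variable [NumberField F] {J : Ideal (𝓞 F)}

variable (ι J) in
/-- The image of an ideal of the ring of integers under a complex embedding. -/
def idealLattice : AddSubgroup ℂ := J.toAddSubgroup.map (integersHom ι).toAddMonoidHom

theorem exists_equiv_embeddings (hdeg : Module.finrank ℚ F = 2) (him : IsEmpty (F →+* ℝ)) :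
    ∃ e : Fin 2 ≃ (F →ₐ[ℚ] ℂ), (∀ x, e 0 x = ι x) ∧ ∀ x, e 1 x = starRingEnd ℂ (ι x) := by
  let f : Fin 2 → (F →ₐ[ℚ] ℂ) :=
    ![ι.toRatAlgHom, (ComplexEmbedding.conjugate ι).toRatAlgHom]
  have hf : Function.Injective f := by
    intro i j hij
    have h01 : f 0 ≠ f 1 := fun h =>
      conj_ne_of_isEmpty (ι := ι) him (RingHom.ext fun x => (DFunLike.congr_fun h x).symm)
    fin_cases i <;> fin_cases j <;> first | rfl | exact absurd hij h01 | exact absurd hij.symm h01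
  have hb : Function.Bijective f := by
    rw [Fintype.bijective_iff_injective_and_card, AlgHom.card, hdeg]
    exact ⟨hf, by simp⟩
  exact ⟨Equiv.ofBijective f hb, fun x => rfl, fun x => rfl⟩

theorem exists_nat_norm_sq (hdeg : Module.finrank ℚ F = 2) (him : IsEmpty (F →+* ℝ)) (x : 𝓞 F) :
    ∃ k : ℕ, ‖integersHom ι x‖ ^ 2 = k := by
  obtain ⟨e, he0, he1⟩ := exists_equiv_embeddings (ι := ι) hdeg him
  have h := Algebra.norm_eq_prod_embeddings ℚ ℂ (x : F)
  rw [← Fintype.prod_equiv e _ _ fun i => rfl, Fin.prod_univ_two, he0, he1, Complex.mul_conj,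
    ← Algebra.coe_norm_int] at h
  have h2 : ((Algebra.norm ℤ x : ℤ) : ℝ) = ‖integersHom ι x‖ ^ 2 := by
    rw [← Complex.normSq_eq_norm_sq]
    rw [eq_ratCast, Rat.cast_intCast] at h
    exact_mod_cast h
  refine ⟨(Algebra.norm ℤ x).toNat, ?_⟩
  have h3 : 0 ≤ Algebra.norm ℤ x := by
    have : (0 : ℝ) ≤ ((Algebra.norm ℤ x : ℤ) : ℝ) := h2 ▸ by positivity
    exact_mod_cast this
  rw [← h2]
  exact_mod_cast (Int.toNat_of_nonneg h3).symm

theorem Complex.sq_mul_conj_sub_mul_conj (z w : ℂ) :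
    (z * starRingEnd ℂ w - starRingEnd ℂ z * w) ^ 2 =
      ((-(4 * (z.re * w.im - w.re * z.im) ^ 2) : ℝ) : ℂ) := by
  apply Complex.ext
  · simp [pow_two]
    ring
  · simp [pow_two]

theorem det_basis_sq (hdeg : Module.finrank ℚ F = 2) (him : IsEmpty (F →+* ℝ))
    (bJ : Module.Basis (Fin 2) ℤ J) :
    4 * ((integersHom ι (bJ 0)).re * (integersHom ι (bJ 1)).im -
      (integersHom ι (bJ 1)).re * (integersHom ι (bJ 0)).im) ^ 2 =
      (Ideal.absNorm J : ℝ) ^ 2 * |(discr F : ℝ)| := by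
  obtain ⟨e, he0, he1⟩ := exists_equiv_embeddings (ι := ι) hdeg him
  let bO : Module.Basis (Fin 2) ℤ (𝓞 F) :=
    (Module.finBasisOfFinrankEq ℤ (𝓞 F) (by rw [RingOfIntegers.rank, hdeg]))
  let P : Matrix (Fin 2) (Fin 2) ℤ := bO.toMatrix (Subtype.val ∘ bJ)
  let bF := bO.localizationLocalization ℚ (nonZeroDivisors ℤ) F
  have h1 : Algebra.discr ℚ bF = discr F := by
    rw [Algebra.discr_localizationLocalization, discr_eq_discr]
    simp
  have h2 : (fun i => ((bJ i : 𝓞 F) : F)) =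
      Matrix.vecMul bF ((P.map (algebraMap ℤ ℚ)).map (algebraMap ℚ F)) := by
    funext i
    have := bO.sum_toMatrix_smul_self (Subtype.val ∘ bJ) i
    have := congrArg (algebraMap (𝓞 F) F) this
    simp only [Matrix.vecMul, dotProduct, Matrix.map_apply]
    rw [Function.comp_apply] at this
    refine this.symm.trans ?_
    rw [map_sum]
    refine Finset.sum_congr rfl fun j _ => ?_
    simp [bF, P, mul_comm]
  have h3 := Algebra.discr_of_matrix_vecMul bF (P.map (algebraMap ℤ ℚ))
  rw [← h2, h1] at h3
  have h4 := Algebra.discr_eq_det_embeddingsMatrixReindex_pow_two ℚ ℂ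
    (fun i => ((bJ i : 𝓞 F) : F)) e
  rw [h3, Matrix.det_fin_two (Algebra.embeddingsMatrixReindex _ _ _ _)] at h4
  simp only [Algebra.embeddingsMatrixReindex, Algebra.embeddingsMatrix, Matrix.reindex_apply,
    Matrix.submatrix_apply, Matrix.of_apply, Equiv.refl_symm, Equiv.refl_apply, Equiv.symm_symm,
    he0, he1] at h4
  have h5 : ((P.det : ℤ) : ℝ) ^ 2 * discr F = -(4 * ((integersHom ι (bJ 0)).re *
      (integersHom ι (bJ 1)).im - (integersHom ι (bJ 1)).re * (integersHom ι (bJ 0)).im) ^ 2) := by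
    have hP : (P.map (algebraMap ℤ ℚ)).det = (P.det : ℚ) := (RingHom.map_det _ P).symm
    rw [hP] at h4
    apply Complex.ofReal_injective
    rw [eq_ratCast, Rat.cast_mul, Rat.cast_pow, Rat.cast_intCast, Rat.cast_intCast] at h4
    rw [Complex.ofReal_mul, Complex.ofReal_pow, Complex.ofReal_intCast, Complex.ofReal_intCast, h4]
    exact Complex.sq_mul_conj_sub_mul_conj _ _
  have h6 : (Ideal.absNorm J : ℝ) ^ 2 = ((P.det : ℤ) : ℝ) ^ 2 := by
    rw [← Ideal.natAbs_det_basis_change bO J bJ, Nat.cast_natAbs, Int.cast_abs, sq_abs]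
    rfl
  rw [h6, ← abs_sq ((P.det : ℤ) : ℝ), ← abs_mul, h5, abs_neg, abs_of_nonneg (by positivity)]

variable (ι) in
theorem exists_isIdealLattice (hdeg : Module.finrank ℚ F = 2) (him : IsEmpty (F →+* ℝ))
    (hJ : J ≠ 0) :
    ∃ D Δ, IsIdealLattice (integersHom ι).range (idealLattice ι J) D Δ ∧
      (volume D).toReal = Ideal.absNorm J * √|(discr F : ℝ)| / 2 := by
  let bJ : Module.Basis (Fin 2) ℤ J := Ideal.selfBasis
    (Module.finBasisOfFinrankEq ℤ (𝓞 F) (by rw [RingOfIntegers.rank, hdeg])) J hJ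
  have hdet := det_basis_sq (ι := ι) hdeg him bJ
  set z : Fin 2 → ℂ := fun i => integersHom ι (bJ i) with hz
  have hN : 0 < (Ideal.absNorm J : ℝ) := by
    exact_mod_cast Nat.pos_of_ne_zero fun h => hJ (Ideal.absNorm_eq_zero_iff.1 h)
  have hΔ : 0 < |(discr F : ℝ)| := abs_pos.2 (by exact_mod_cast discr_ne_zero F)
  have hne : (z 0).re * (z 1).im - (z 1).re * (z 0).im ≠ 0 := by
    intro h0
    rw [show (integersHom ι (bJ 0)).re * (integersHom ι (bJ 1)).im -
      (integersHom ι (bJ 1)).re * (integersHom ι (bJ 0)).im = 0 from h0] at hdet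
    have : 0 < (Ideal.absNorm J : ℝ) ^ 2 * |(discr F : ℝ)| := by positivity
    rw [← hdet] at this
    norm_num at this
  have hunit : IsUnit (Complex.basisOneI.det z) := by
    rw [Module.Basis.det_apply, Matrix.det_fin_two, isUnit_iff_ne_zero]
    simpa [Module.Basis.toMatrix_apply] using hne
  obtain ⟨hli, hsp⟩ := (Module.Basis.is_basis_iff_det _).2 hunit
  let b : Module.Basis (Fin 2) ℝ ℂ := Module.Basis.mk hli hsp.ge
  have hb : ⇑b = z := Module.Basis.coe_mk _ _
  have hspan : (Submodule.span ℤ (Set.range b)).toAddSubgroup = idealLattice ι J := by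
    rw [hb]
    let f : J →ₗ[ℤ] ℂ := ((integersHom ι).toAddMonoidHom.comp J.toAddSubgroup.subtype).toIntLinearMap
    have h1 : Set.range z = f '' Set.range bJ := by
      rw [← Set.range_comp]
      rfl
    rw [h1, ← Submodule.map_span, bJ.span_eq, Submodule.map_top]
    ext x
    simp only [f, idealLattice, Submodule.mem_toAddSubgroup, LinearMap.mem_range,
      AddSubgroup.mem_map]
    exact ⟨fun ⟨y, hy⟩ => ⟨y, y.2, hy⟩, fun ⟨y, hyJ, hy⟩ => ⟨⟨y, hyJ⟩, hy⟩⟩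
  obtain ⟨R, hR0, hR⟩ := exists_coveredBy_span b
  have hvol := Complex.volume_fundamentalDomain b
  refine ⟨ZSpan.fundamentalDomain b, R, ⟨?_, ?_, ?_, ?_, ?_, ?_, hR0,
    ZSpan.measure_fundamentalDomain_ne_zero b,
    (ZSpan.fundamentalDomain_isBounded b).measure_lt_top.ne⟩, ?_⟩
  · have : Countable (𝓞 F) := (Module.finBasisOfFinrankEq ℤ (𝓞 F)
      (by rw [RingOfIntegers.rank, hdeg])).equivFun.toEquiv.countable_iff.2 inferInstance
    exact (Set.countable_range (integersHom ι)).to_subtype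
  · rintro _ ⟨x, rfl⟩
    exact exists_nat_norm_sq hdeg him x
  · rintro _ ⟨x, -, rfl⟩
    exact ⟨x, rfl⟩
  · rintro _ ⟨x, rfl⟩ _ ⟨l, hl, rfl⟩
    exact ⟨x * l, J.mul_mem_left x hl, map_mul (integersHom ι) x l⟩
  · rw [← hspan]
    exact isTile_fundamentalDomain b
  · rwa [← hspan]
  · rw [hvol, hb]
    refine (sq_eq_sq₀ (by positivity) (by positivity)).1 ?_
    rw [sq_abs, div_pow, mul_pow, Real.sq_sqrt hΔ.le, ← hdet]
    simp only [hz]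
    ring

end IdealLattice

section Counting

variable {F : Type*} [Field F] [NumberField F] (ι : F →+* ℂ) (J : Ideal (𝓞 F))

/-- Vectors with entries in an ideal correspond to vectors with entries in its image lattice. -/
def piIdealEquiv (k : ℕ) : (Fin k → J) ≃ piSubgroup (Fin k) (idealLattice ι J) :=
  Equiv.ofBijective (fun x => ⟨fun i => integersHom ι (x i),
    mem_piSubgroup.2 fun i => ⟨x i, (x i).2, rfl⟩⟩)
    ⟨fun x y h => funext fun i => Subtype.ext (integersHom_injective (ι := ι)
      (congrFun (congrArg Subtype.val h) i)), fun y => by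
      choose x hx using fun i => mem_piSubgroup.1 y.2 i
      exact ⟨fun i => ⟨x i, (hx i).1⟩, Subtype.ext (funext fun i => (hx i).2)⟩⟩

theorem ENat.toReal_toENNReal (x : ℕ∞) : (x : ℝ≥0∞).toReal = x.toNat := by
  cases x <;> simp

theorem solCount_eq_toReal_solutions {m n : ℕ} (hm : 1 ≤ m) {ψ : ℝ → ℝ}
    (hψpos : ∀ t, 1 ≤ t → 0 < ψ t) (v : (Fin m → 𝓞 F) × (Fin n → 𝓞 F))
    (θ : Matrix (Fin m) (Fin n) ℂ) (T : ℝ) :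
    (solCount F ι m n ψ J v θ T : ℝ) = (solutions (idealLattice ι J) ψ
      (fun i => integersHom ι (v.1 i)) (fun j => integersHom ι (v.2 j)) T θ).toReal := by
  classical
  set S : Set ((Fin m → 𝓞 F) × (Fin n → 𝓞 F)) := {pq |
    cnorm (fun i => θ.mulVec (fun j => ι (pq.2 j : F)) i + ι (pq.1 i : F)) ^ m
        ≤ ψ (cnorm (fun j => ι (pq.2 j : F)) ^ n) ∧
    1 ≤ cnorm (fun j => ι (pq.2 j : F)) ^ n ∧
    cnorm (fun j => ι (pq.2 j : F)) ^ n < T ∧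
    (∀ i, pq.1 i - v.1 i ∈ J) ∧ (∀ j, pq.2 j - v.2 j ∈ J)} with hS
  let g : (Fin n → J) × (Fin m → J) → (Fin m → 𝓞 F) × (Fin n → 𝓞 F) := fun x =>
    (fun i => v.1 i + x.2 i, fun j => v.2 j + x.1 j)
  have hg : Function.Injective g := by
    rintro ⟨x, y⟩ ⟨x', y'⟩ h
    simp only [g, Prod.mk.injEq, funext_iff, add_right_inj, SetLike.coe_eq_coe] at h
    exact Prod.ext (funext h.2) (funext h.1)
  have himage : g '' (g ⁻¹' S) = S := by
    refine Set.image_preimage_eq_of_subset ?_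
    rintro ⟨p, q⟩ ⟨-, -, -, hp, hq⟩
    exact ⟨(fun j => ⟨_, hq j⟩, fun i => ⟨_, hp i⟩), by simp [g]⟩
  have hsum : solutions (idealLattice ι J) ψ (fun i => integersHom ι (v.1 i))
      (fun j => integersHom ι (v.2 j)) T θ = S.encard := by
    rw [← himage, hg.encard_image, ← ENNReal.tsum_set_one, tsum_subtype (g ⁻¹' S) fun _ => 1,
      ENNReal.tsum_prod']
    unfold solutions
    rw [← (piIdealEquiv ι J n).tsum_eq]
    refine tsum_congr fun l => ?_
    set q : Fin n → ℂ := (fun j => integersHom ι (v.2 j)) + (piIdealEquiv ι J n l : Fin n → ℂ)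
      with hq
    have hgq (p) : (fun j => ι ((g (l, p)).2 j : F)) = q :=
      funext fun j => map_add (integersHom ι) _ _
    unfold hitsBelow
    by_cases ht : ‖q‖ ^ (2 * n) ∈ Set.Ico 1 T
    · rw [Set.indicator_of_mem ht]
      unfold hits cnt
      rw [← (piIdealEquiv ι J m).tsum_eq]
      refine tsum_congr fun p => ?_
      have hgp : (fun i => θ.mulVec q i + ι ((g (l, p)).1 i : F)) =
          app θ q + (fun i => integersHom ι (v.1 i)) + (piIdealEquiv ι J m p : Fin m → ℂ) :=
        funext fun i => (congrArg (_ + ·) (map_add (integersHom ι) _ _)).trans (add_assoc _ _ _).symm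
      rw [Set.indicator_apply, Set.indicator_apply]
      refine if_congr ?_ rfl rfl
      rw [mem_closedBall_zero_iff, norm_le_radius_iff hm (hψpos _ ht.1).le, Set.mem_preimage, hS,
        Set.mem_ofPred_eq]
      simp only [hgq, hgp, cnorm_eq_norm_sq, ← pow_mul]
      simp [g, ht.1, ht.2]
    · rw [Set.indicator_of_notMem ht]
      symm
      rw [ENNReal.tsum_eq_zero]
      intro p
      refine Set.indicator_of_notMem ?_ _
      rw [Set.mem_preimage, hS, Set.mem_ofPred_eq]
      simp only [hgq, cnorm_eq_norm_sq, ← pow_mul]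
      exact fun h => ht ⟨h.2.1, h.2.2.1⟩
  rw [hsum, ENat.toReal_toENNReal]
  rfl

end Counting

theorem inv_covolume_pow {N Δ : ℝ} (hN : 0 < N) (hΔ : 0 < Δ) (m n : ℕ) :
    (N * √Δ / 2)⁻¹ ^ (m + n) =
      2 ^ (m + n) * Δ ^ (-(m + n : ℝ) / 2) * N ^ (-(m + n : ℝ)) := by
  have h1 : Δ ^ (-(m + n : ℝ) / 2) = (√Δ ^ (m + n))⁻¹ := by
    rw [Real.sqrt_eq_rpow, ← Real.rpow_natCast, ← Real.rpow_mul hΔ.le, ← Real.rpow_neg hΔ.le]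
    congr 1
    push_cast
    ring
  have h2 : N ^ (-(m + n : ℝ)) = (N ^ (m + n))⁻¹ := by
    rw [Real.rpow_neg hN.le, ← Real.rpow_natCast]
    push_cast
    rfl
  rw [h1, h2, inv_div, div_pow, mul_pow, div_eq_mul_inv, mul_inv]
  ring

/-- Theorem 1.5 of the paper: let `F` be an imaginary quadratic number field with ring
of integers `𝒪`, `m, n ≥ 1` with `d = m + n ≥ 3`, `𝔍` a nonzero ideal of `𝒪`,
`v ∈ 𝒪^m × 𝒪^n`, and `ψ : [1,∞) → (0,∞)` decreasing with `∫_1^∞ ψ(t) dt = ∞`.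
Then for Lebesgue-almost every `θ ∈ M_{m×n}(ℂ)`,
`𝒩(θ, T, v, 𝔍) ∼ 2^d |Δ_F|^{-d/2} N(𝔍)^{-d} vol(E_{T,∞})` as `T → ∞`. -/
theorem schmidt_counting_imaginary_quadratic
    (F : Type*) [Field F] [NumberField F]
    (hdeg : Module.finrank ℚ F = 2) (him : IsEmpty (F →+* ℝ))
    (ι : F →+* ℂ)
    (m n : ℕ) (hm : 1 ≤ m) (hn : 1 ≤ n) (hd : 3 ≤ m + n)
    (J : Ideal (𝓞 F)) (hJ : J ≠ 0)
    (v : (Fin m → 𝓞 F) × (Fin n → 𝓞 F))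
    (ψ : ℝ → ℝ) (hψpos : ∀ t, 1 ≤ t → 0 < ψ t) (hψdec : AntitoneOn ψ (Set.Ici 1))
    (hdiv : Tendsto (fun T : ℝ => ∫ t in (1:ℝ)..T, ψ t) atTop atTop) :
    ∀ᵐ θ : Matrix (Fin m) (Fin n) ℂ,
      Tendsto (fun T : ℝ =>
          (solCount F ι m n ψ J v θ T : ℝ) /
            (2 ^ (m + n) * |(NumberField.discr F : ℝ)| ^ (-(m + n : ℝ) / 2)
              * (Ideal.absNorm J : ℝ) ^ (-(m + n : ℝ))
              * (volume (Einf m n ψ T)).toReal))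
        atTop (𝓝 1) := by
  obtain ⟨D, Δ, h, hV⟩ := exists_isIdealLattice ι hdeg him hJ
  have hN : 0 < (Ideal.absNorm J : ℝ) := by
    exact_mod_cast Nat.pos_of_ne_zero fun h => hJ (Ideal.absNorm_eq_zero_iff.1 h)
  have hΔ : 0 < |(discr F : ℝ)| := abs_pos.2 (by exact_mod_cast discr_ne_zero F)
  have hae := h.ae_tendsto hm hn hd hψdec hψpos hdiv (fun i => integersHom ι (v.1 i))
    (w := fun j => integersHom ι (v.2 j)) fun j => ⟨v.2 j, rfl⟩
  rw [hV, inv_covolume_pow hN hΔ] at hae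
  change ∀ᵐ θ : Fin m → Fin n → ℂ, _
  filter_upwards [hae] with θ hθ
  have hc : 0 < 2 ^ (m + n) * |(discr F : ℝ)| ^ (-(m + n : ℝ) / 2) *
      (Ideal.absNorm J : ℝ) ^ (-(m + n : ℝ)) := by positivity
  have h1 := hθ.2.div_const (2 ^ (m + n) * |(discr F : ℝ)| ^ (-(m + n : ℝ) / 2) *
      (Ideal.absNorm J : ℝ) ^ (-(m + n : ℝ)))
  rw [div_self hc.ne'] at h1
  refine h1.congr fun T => ?_
  rw [solCount_eq_toReal_solutions ι J hm hψpos v θ T, div_div, mul_comm (volume _).toReal]
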